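/- With K, 𝔟, ω = [[a₀,…,a_{r−1}]], ℓ, α_i, β_i, Q as in the context (and α_{−2} = 1, β_{−2} = −a₀, a indices read modulo r so a_ℓ = a₀), define for 0 ≤ i ≤ ℓ−1 the rational numbers L_i, M_i, N_i by the polynomial identity Q(α_ih₁ − α_{i−1}h₂, β_ih₁ − β_{i−1}h₂) = L_ih₁² + M_ih₁h₂ + N_ih₂², and L̃_i, M̃_i, Ñ_i by Q(α_{i−2}h₁ + α_ih₂, β_{i−2}h₁ + β_ih₂) = L̃_ih₁² + M̃_ih₁h₂ + Ñ_ih₂². Then ζ(−1,𝔟) = (1/720)·Σ_{i=0}^{ℓ−1} (−1)^{i−1}·( 5M_i + a_{ℓ−i}·(2L̃_i + M̃_i + 2Ñ_i) ). -/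

import Mathlib

open NumberField
open scoped nonZeroDivisors
open Classical

noncomputable section

/-- The weight function of the (oriented) lattice cone spanned by `v₁, v₂`:
`1` on interior lattice points, `1/2` on nonzero lattice points of the boundary rays,
`0` elsewhere. -/
def wt (v₁ v₂ : ℝ × ℝ) (m : ℤ × ℤ) : ℝ :=
  if ∃ x₁ x₂ : ℝ, 0 < x₁ ∧ 0 < x₂ ∧ ((m.1 : ℝ), (m.2 : ℝ)) = x₁ • v₁ + x₂ • v₂ then 1
  else if ∃ t : ℝ, 0 < t ∧
      (((m.1 : ℝ), (m.2 : ℝ)) = t • v₁ ∨ ((m.1 : ℝ), (m.2 : ℝ)) = t • v₂) then 1 / 2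
  else 0

section helpers

open MeasureTheory Filter Topology

/-- `q^(-s)` for positive `q`. -/
def pw (q : ℝ) (s : ℂ) : ℂ := Complex.exp (-s * (Real.log q : ℂ))

lemma pw_norm {q : ℝ} (hq : 0 < q) (s : ℂ) : ‖pw q s‖ = q ^ (-s.re) := by
  rw [pw, Complex.norm_exp, Real.rpow_def_of_pos hq]
  congr 1
  simp [mul_comm]

lemma pw_ne {q : ℝ} (s : ℂ) : pw q s ≠ 0 := Complex.exp_ne_zero _

lemma pw_add_one {q : ℝ} (hq : 0 < q) (s : ℂ) : pw q s = q * pw q (s + 1) := by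
  have h : (q : ℂ) = Complex.exp (Real.log q : ℂ) := by
    rw [← Complex.ofReal_exp, Real.exp_log hq]
  conv_rhs => rw [h]
  rw [pw, pw, ← Complex.exp_add]
  congr 1
  ring

lemma pw_mul {p q : ℝ} (hp : 0 < p) (hq : 0 < q) (s : ℂ) : pw (p * q) s = pw p s * pw q s := by
  rw [pw, pw, pw, ← Complex.exp_add, Real.log_mul hp.ne' hq.ne']
  congr 1
  push_cast
  ring

lemma pw_zero (q : ℝ) : pw q 0 = 1 := by simp [pw]

lemma pw_neg_one {q : ℝ} (hq : 0 < q) : pw q (-1) = q := by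
  rw [pw_add_one hq]; simp [pw_zero]

lemma pw_one {q : ℝ} (hq : 0 < q) : pw q 1 = (q : ℂ)⁻¹ := by
  have := pw_add_one hq 0
  rw [pw_zero, zero_add] at this
  exact (eq_inv_of_mul_eq_one_right this.symm)

lemma pw_two {q : ℝ} (hq : 0 < q) : pw q 2 = ((q : ℂ)⁻¹) ^ 2 := by
  have := pw_add_one hq 1
  rw [pw_one hq, show (1 : ℂ) + 1 = 2 by norm_num] at this
  have hq' : (q : ℂ) ≠ 0 := by exact_mod_cast hq.ne'
  field_simp at this ⊢
  linear_combination -this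

lemma pw_diff (q : ℝ) : Differentiable ℂ (pw q) := by
  unfold pw; fun_prop

lemma pw_hasDerivAt {q : ℝ → ℝ} {q' x : ℝ} (hq : HasDerivAt q q' x) (h : 0 < q x) (s : ℂ) :
    HasDerivAt (fun y => pw (q y) s) (-s * q' * pw (q x) (s + 1)) x := by
  have h1 := (hq.log h.ne').ofReal_comp
  have h2 := (h1.const_mul (-s)).cexp
  refine h2.congr_deriv ?_
  change pw (q x) s * _ = _
  rw [pw_add_one h s]
  have hq' : (q x : ℂ) ≠ 0 := by exact_mod_cast h.ne'
  push_cast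
  field_simp

lemma pw_cpow {n : ℕ} (hn : 0 < n) (s : ℂ) : pw ((n : ℝ) ^ 2) s = 1 / (n : ℂ) ^ (2 * s) := by
  have hn' : (n : ℂ) ≠ 0 := by exact_mod_cast hn.ne'
  rw [pw, Complex.cpow_def_of_ne_zero hn', one_div, ← Complex.exp_neg, Real.log_pow]
  congr 1
  rw [show (n : ℂ) = ((n : ℝ) : ℂ) by simp, ← Complex.ofReal_log (by positivity)]
  push_cast
  ring

/-- holomorphy of parametric integrals -/
lemma hol_integral {α : Type*} [MeasurableSpace α] {μ : Measure α} {U : Set ℂ} (hU : IsOpen U)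
    (F : ℂ → α → ℂ) (hm : ∀ s ∈ U, AEStronglyMeasurable (F s) μ)
    (hd : ∀ᵐ x ∂μ, DifferentiableOn ℂ (fun s => F s x) U)
    (hb : ∀ s₀ ∈ U, ∃ V ∈ 𝓝 s₀, ∃ g : α → ℝ, Integrable g μ ∧
      ∀ᵐ x ∂μ, ∀ s ∈ V, ‖F s x‖ ≤ g x) :
    DifferentiableOn ℂ (fun s => ∫ x, F s x ∂μ) U := by
  intro s₀ hs₀
  obtain ⟨V, hV, g, hg, hb⟩ := hb s₀ hs₀
  obtain ⟨R, hR, hball⟩ := Metric.mem_nhds_iff.1 (Filter.inter_mem hV (hU.mem_nhds hs₀))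
  have hR2 : 0 < R / 2 := by positivity
  have key := hasDerivAt_integral_of_dominated_loc_of_deriv_le (𝕜 := ℂ) (μ := μ) (F := F)
    (x₀ := s₀) (s := Metric.ball s₀ (R / 2)) (bound := fun x => g x / (R / 4))
    (F' := fun s x => deriv (fun s => F s x) s) (Metric.ball_mem_nhds _ hR2) ?_ ?_ ?_ ?_ ?_ ?_
  · exact key.2.differentiableAt.differentiableWithinAt
  · filter_upwards [hU.mem_nhds hs₀] with s hs using hm s hs
  · refine hg.mono' (hm s₀ hs₀) ?_
    filter_upwards [hb] with x hx using hx s₀ (mem_of_mem_nhds hV)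
  · -- measurability of the derivative
    have hseq : Tendsto (fun n : ℕ => s₀ + (R / 2 : ℂ) * (1 / ((n : ℂ) + 1))) atTop (𝓝[≠] s₀) := by
      refine tendsto_nhdsWithin_iff.2 ⟨?_, ?_⟩
      · have h0 : Tendsto (fun n : ℕ => 1 / ((n : ℂ) + 1)) atTop (𝓝 0) :=
          tendsto_one_div_add_atTop_nhds_zero_nat
        simpa using (h0.const_mul (R / 2 : ℂ)).const_add s₀
      · refine Filter.Eventually.of_forall fun n => ?_
        have h1 : (R : ℂ) ≠ 0 := by exact_mod_cast hR.ne'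
        have h2 : (n : ℂ) + 1 ≠ 0 := by exact_mod_cast Nat.succ_ne_zero n
        simp [h1, h2]
    have hsU : ∀ᶠ n : ℕ in atTop, s₀ + (R / 2 : ℂ) * (1 / ((n : ℂ) + 1)) ∈ U :=
      (tendsto_nhds_of_tendsto_nhdsWithin hseq).eventually (hU.mem_nhds hs₀)
    obtain ⟨n₀, hn₀⟩ := Filter.eventually_atTop.1 hsU
    refine aestronglyMeasurable_of_tendsto_ae (u := atTop)
      (f := fun (n : ℕ) x => slope (fun s => F s x) s₀
        (s₀ + (R / 2 : ℂ) * (1 / (((n + n₀ : ℕ) : ℂ) + 1)))) ?_ ?_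
    · intro n
      simp only [slope_def_field, div_eq_mul_inv]
      exact ((hm _ (hn₀ (n + n₀) (by omega))).sub (hm _ hs₀)).mul_const _
    · filter_upwards [hd] with x hx
      have := ((hx s₀ hs₀).differentiableAt (hU.mem_nhds hs₀)).hasDerivAt
      exact (hasDerivAt_iff_tendsto_slope.1 this).comp
        (hseq.comp (tendsto_add_atTop_nat n₀))
  · filter_upwards [hb, hd] with x hx hdx s hs
    have hsub : Metric.closedBall s (R / 4) ⊆ V ∩ U := by
      refine subset_trans (fun z hz => ?_) hball
      rw [Metric.mem_ball] at hs ⊢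
      rw [Metric.mem_closedBall] at hz
      linarith [dist_triangle z s s₀]
    refine Complex.norm_deriv_le_of_forall_mem_sphere_norm_le (by positivity) ?_ ?_
    · refine DifferentiableOn.diffContOnCl ?_
      rw [closure_ball _ (by positivity)]
      exact hdx.mono (hsub.trans Set.inter_subset_right)
    · intro z hz
      exact hx z (hsub (Metric.sphere_subset_closedBall hz)).1
  · exact hg.div_const _
  · filter_upwards [hd] with x hx s hs
    have hs' : s ∈ U := (hball (Metric.ball_subset_ball (by linarith) hs)).2
    exact ((hx s hs').differentiableAt (hU.mem_nhds hs')).hasDerivAt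

def P5 (x : ℝ) : ℝ := (x ^ 5 - 5 / 2 * x ^ 4 + 5 / 3 * x ^ 3 - x / 6) / 120

lemma P5_cont : Continuous P5 := by unfold P5; fun_prop

lemma P5_bound {x : ℝ} (h : x ∈ Set.Icc (0 : ℝ) 1) : |P5 x| ≤ 1 := by
  obtain ⟨h0, h1⟩ := h
  have h2 : x ^ 2 ≤ 1 := pow_le_one₀ h0 h1
  have h3 : x ^ 3 ≤ 1 := pow_le_one₀ h0 h1
  have h4 : x ^ 4 ≤ 1 := pow_le_one₀ h0 h1
  have h5 : x ^ 5 ≤ 1 := pow_le_one₀ h0 h1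
  have h3' : 0 ≤ x ^ 3 := by positivity
  have h4' : 0 ≤ x ^ 4 := by positivity
  have h5' : 0 ≤ x ^ 5 := by positivity
  rw [P5, abs_le]
  constructor <;> linarith

lemma em_step (g g1 g2 g3 g4 g5 : ℝ → ℂ)
    (h0 : ∀ x, 0 ≤ x → HasDerivAt g (g1 x) x) (h1 : ∀ x, 0 ≤ x → HasDerivAt g1 (g2 x) x)
    (h2 : ∀ x, 0 ≤ x → HasDerivAt g2 (g3 x) x) (h3 : ∀ x, 0 ≤ x → HasDerivAt g3 (g4 x) x)
    (h4 : ∀ x, 0 ≤ x → HasDerivAt g4 (g5 x) x) (h5 : ContinuousOn g5 (Set.Ici 0)) :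
    (g 0 + g 1) / 2 = (∫ x in (0 : ℝ)..1, g x) + (∫ x in (0 : ℝ)..1, (P5 x : ℂ) * g5 x)
      + (g1 1 - g1 0) / 12 - (g3 1 - g3 0) / 720 := by
  have hc0 : ContinuousOn g (Set.Icc 0 1) := fun x hx =>
    (h0 x hx.1).continuousAt.continuousWithinAt
  have hc5 : ContinuousOn (fun x => (P5 x : ℂ) * g5 x) (Set.Icc 0 1) :=
    (Complex.continuous_ofReal.comp P5_cont).continuousOn.mul (h5.mono fun x hx => hx.1)
  have i0 : IntervalIntegrable g volume 0 1 := hc0.intervalIntegrable_of_Icc (by norm_num)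
  have i5 : IntervalIntegrable (fun x => (P5 x : ℂ) * g5 x) volume 0 1 :=
    hc5.intervalIntegrable_of_Icc (by norm_num)
  rw [← intervalIntegral.integral_add i0 i5]
  have key := intervalIntegral.integral_eq_sub_of_hasDerivAt (a := 0) (b := 1)
    (f := fun x : ℝ => ((x : ℂ) - 1 / 2) * g x
      - ((x : ℂ) ^ 2 / 2 - (x : ℂ) / 2 + 1 / 12) * g1 x
      + (((x : ℂ) ^ 3 - 3 / 2 * (x : ℂ) ^ 2 + (x : ℂ) / 2) / 6) * g2 x
      - (((x : ℂ) ^ 4 - 2 * (x : ℂ) ^ 3 + (x : ℂ) ^ 2 - 1 / 30) / 24) * g3 x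
      + (((x : ℂ) ^ 5 - 5 / 2 * (x : ℂ) ^ 4 + 5 / 3 * (x : ℂ) ^ 3 - (x : ℂ) / 6) / 120) * g4 x)
    (f' := fun x => g x + (P5 x : ℂ) * g5 x) ?_ (i0.add i5)
  · rw [key]
    push_cast
    ring
  · intro x hx
    rw [Set.uIcc_of_le (by norm_num)] at hx
    have hx0 := hx.1
    have hid : HasDerivAt (fun x : ℝ => (x : ℂ)) 1 x := Complex.ofRealCLM.hasDerivAt
    have p2 := hid.fun_pow 2
    have p3 := hid.fun_pow 3
    have p4 := hid.fun_pow 4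
    have p5 := hid.fun_pow 5
    have d1 := (hid.sub_const (1 / 2 : ℂ)).fun_mul (h0 x hx0)
    have d2 := (((p2.div_const 2).fun_sub (hid.div_const 2)).add_const (1 / 12 : ℂ)).fun_mul (h1 x hx0)
    have d3 := (((p3.fun_sub (p2.const_mul (3 / 2 : ℂ))).fun_add (hid.div_const 2)).div_const 6).fun_mul
      (h2 x hx0)
    have d4 := ((((p4.fun_sub (p3.const_mul (2 : ℂ))).fun_add p2).sub_const (1 / 30 : ℂ)).div_const
      24).fun_mul (h3 x hx0)
    have d5 := ((((p5.fun_sub (p4.const_mul (5 / 2 : ℂ))).fun_add (p3.const_mul (5 / 3 : ℂ))).fun_sub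
      (hid.div_const 6)).div_const 120).fun_mul (h4 x hx0)
    refine ((((d1.fun_sub d2).fun_add d3).fun_sub d4).fun_add d5).congr_deriv ?_
    simp only [P5]
    push_cast
    ring

lemma em_full (g g1 g2 g3 g4 g5 : ℝ → ℂ)
    (h0 : ∀ x, 0 ≤ x → HasDerivAt g (g1 x) x) (h1 : ∀ x, 0 ≤ x → HasDerivAt g1 (g2 x) x)
    (h2 : ∀ x, 0 ≤ x → HasDerivAt g2 (g3 x) x) (h3 : ∀ x, 0 ≤ x → HasDerivAt g3 (g4 x) x)
    (h4 : ∀ x, 0 ≤ x → HasDerivAt g4 (g5 x) x) (h5 : ContinuousOn g5 (Set.Ici 0))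
    (hgInt : IntegrableOn g (Set.Ioi 0)) (hs : Summable (fun m : ℕ => g m))
    (hr : Summable (fun m : ℕ => ∫ x in (0 : ℝ)..1, (P5 x : ℂ) * g5 (m + x)))
    (l1 : Tendsto (fun m : ℕ => g1 m) atTop (𝓝 0)) (l3 : Tendsto (fun m : ℕ => g3 m) atTop (𝓝 0)) :
    (∑' m : ℕ, g m) - g 0 / 2 = (∫ x in Set.Ioi (0 : ℝ), g x) - g1 0 / 12 + g3 0 / 720
      + ∑' m : ℕ, ∫ x in (0 : ℝ)..1, (P5 x : ℂ) * g5 (m + x) := by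
  have hstep : ∀ m : ℕ, (g m + g (m + 1)) / 2 = (∫ x in (m : ℝ)..(m + 1 : ℕ), g x)
      + (∫ x in (0 : ℝ)..1, (P5 x : ℂ) * g5 (m + x))
      + (g1 (m + 1 : ℕ) - g1 m) / 12 - (g3 (m + 1 : ℕ) - g3 m) / 720 := by
    intro m
    have hm : (0 : ℝ) ≤ m := Nat.cast_nonneg m
    have := em_step (fun x => g (m + x)) (fun x => g1 (m + x)) (fun x => g2 (m + x))
      (fun x => g3 (m + x)) (fun x => g4 (m + x)) (fun x => g5 (m + x))
      (fun x hx => (h0 _ (by positivity)).comp_const_add _ _)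
      (fun x hx => (h1 _ (by positivity)).comp_const_add _ _)
      (fun x hx => (h2 _ (by positivity)).comp_const_add _ _)
      (fun x hx => (h3 _ (by positivity)).comp_const_add _ _)
      (fun x hx => (h4 _ (by positivity)).comp_const_add _ _)
      (h5.comp (by fun_prop) (fun x hx => by
        simp only [Set.mem_Ici] at hx ⊢; positivity))
    rw [intervalIntegral.integral_comp_add_left (fun x => g x) (m : ℝ)] at this
    simpa using this
  have hgi : ∀ p q : ℕ, IntervalIntegrable g volume p q := by
    intro p q
    refine ContinuousOn.intervalIntegrable fun x hx => ?_
    refine (h0 x ?_).continuousAt.continuousWithinAt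
    rcases Set.mem_uIcc.1 hx with h | h
    · exact le_trans (Nat.cast_nonneg p) h.1
    · exact le_trans (Nat.cast_nonneg q) h.1
  have hsum : ∀ M : ℕ, (∑ m ∈ Finset.range M, g m) - g 0 / 2 + g M / 2 =
      (∫ x in (0 : ℝ)..M, g x)
      + (∑ m ∈ Finset.range M, ∫ x in (0 : ℝ)..1, (P5 x : ℂ) * g5 (m + x))
      + (g1 M - g1 0) / 12 - (g3 M - g3 0) / 720 := by
    intro M
    induction M with
    | zero => simp
    | succ M ih =>
      rw [Finset.sum_range_succ, Finset.sum_range_succ,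
        ← intervalIntegral.integral_add_adjacent_intervals (by simpa using hgi 0 M) (hgi M (M + 1))]
      have := hstep M
      push_cast at this ih ⊢
      linear_combination ih + this
  have t0 : Tendsto (fun M : ℕ => g M) atTop (𝓝 0) := hs.tendsto_atTop_zero
  have L := ((hs.hasSum.tendsto_sum_nat.sub_const (g 0 / 2)).add (t0.div_const 2))
  have R := ((((intervalIntegral_tendsto_integral_Ioi 0 hgInt
      tendsto_natCast_atTop_atTop).add hr.hasSum.tendsto_sum_nat).add
      ((l1.sub_const (g1 0)).div_const 12)).sub ((l3.sub_const (g3 0)).div_const 720))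
  have := tendsto_nhds_unique (L.congr hsum) R
  linear_combination this

def qf (a b c n x : ℝ) : ℝ := a * x ^ 2 + b * n * x + c * n ^ 2

def qd (a b n x : ℝ) : ℝ := 2 * a * x + b * n

def G0 (a b c n : ℝ) (s : ℂ) (x : ℝ) : ℂ := pw (qf a b c n x) s

def G1 (a b c n : ℝ) (s : ℂ) (x : ℝ) : ℂ := -s * ((qd a b n x : ℂ) * pw (qf a b c n x) (s + 1))

def G2 (a b c n : ℝ) (s : ℂ) (x : ℝ) : ℂ :=
  -s * (2 * a * pw (qf a b c n x) (s + 1)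
    - (s + 1) * ((qd a b n x : ℂ) ^ 2 * pw (qf a b c n x) (s + 2)))

def G3 (a b c n : ℝ) (s : ℂ) (x : ℝ) : ℂ :=
  s * (s + 1) * (6 * a * ((qd a b n x : ℂ) ^ 1 * pw (qf a b c n x) (s + 2))
    - (s + 2) * ((qd a b n x : ℂ) ^ 3 * pw (qf a b c n x) (s + 3)))

def G4 (a b c n : ℝ) (s : ℂ) (x : ℝ) : ℂ :=
  s * (s + 1) * (12 * a ^ 2 * pw (qf a b c n x) (s + 2)
    - 12 * a * (s + 2) * ((qd a b n x : ℂ) ^ 2 * pw (qf a b c n x) (s + 3))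
    + (s + 2) * (s + 3) * ((qd a b n x : ℂ) ^ 4 * pw (qf a b c n x) (s + 4)))

def G5 (a b c n : ℝ) (s : ℂ) (x : ℝ) : ℂ :=
  s * (s + 1) * (s + 2) * (-(60 * a ^ 2) * ((qd a b n x : ℂ) ^ 1 * pw (qf a b c n x) (s + 3))
    + 20 * a * (s + 3) * ((qd a b n x : ℂ) ^ 3 * pw (qf a b c n x) (s + 4))
    - (s + 3) * (s + 4) * ((qd a b n x : ℂ) ^ 5 * pw (qf a b c n x) (s + 5)))

section quad

lemma norm3_le (A B C : ℂ) : ‖A + B - C‖ ≤ ‖A‖ + ‖B‖ + ‖C‖ :=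
  (norm_sub_le _ _).trans (add_le_add_left (norm_add_le _ _) _)

variable {a b c n : ℝ}

lemma qf_pos (ha : 0 < a) (hb : 0 < b) (hc : 0 < c) (hn : 0 < n) {x : ℝ} (hx : 0 ≤ x) : 0 < qf a b c n x := by unfold qf; positivity

lemma qd_nonneg (ha : 0 < a) (hb : 0 < b) (hn : 0 < n) {x : ℝ} (hx : 0 ≤ x) : 0 ≤ qd a b n x := by unfold qd; positivity

lemma qf_deriv (x : ℝ) : HasDerivAt (qf a b c n) (qd a b n x) x := by
  unfold qf qd
  have h := (((hasDerivAt_id' x).fun_pow 2).const_mul a).fun_add ((hasDerivAt_id' x).const_mul (b * n))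
  refine (h.add_const (c * n ^ 2)).congr_deriv ?_
  norm_num; ring

lemma qd_deriv (x : ℝ) : HasDerivAt (fun x => (qd a b n x : ℂ)) (2 * a) x := by
  have h : HasDerivAt (fun x => qd a b n x) (2 * a) x := by
    unfold qd
    refine (((hasDerivAt_id' x).const_mul (2 * a)).add_const (b * n)).congr_deriv (by ring)
  simpa using h.ofReal_comp

lemma pw_deriv (ha : 0 < a) (hb : 0 < b) (hc : 0 < c) (hn : 0 < n) {x : ℝ} (hx : 0 ≤ x) (s : ℂ) :
    HasDerivAt (fun y => pw (qf a b c n y) s) (-s * qd a b n x * pw (qf a b c n x) (s + 1)) x :=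
  pw_hasDerivAt (qf_deriv x) (qf_pos ha hb hc hn hx) s

lemma dpw_deriv (ha : 0 < a) (hb : 0 < b) (hc : 0 < c) (hn : 0 < n) {x : ℝ} (hx : 0 ≤ x) (k : ℕ) (s : ℂ) :
    HasDerivAt (fun y => (qd a b n y : ℂ) ^ k * pw (qf a b c n y) s)
      (k * (qd a b n x : ℂ) ^ (k - 1) * (2 * a) * pw (qf a b c n x) s
        - s * (qd a b n x : ℂ) ^ (k + 1) * pw (qf a b c n x) (s + 1)) x := by
  refine (((qd_deriv x).fun_pow k).fun_mul (pw_deriv ha hb hc hn hx s)).congr_deriv ?_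
  ring

lemma G0_deriv (ha : 0 < a) (hb : 0 < b) (hc : 0 < c) (hn : 0 < n) {x : ℝ} (hx : 0 ≤ x) (s : ℂ) :
    HasDerivAt (G0 a b c n s) (G1 a b c n s x) x :=
  (pw_deriv ha hb hc hn hx s).congr_deriv (by unfold G1; ring)

lemma G1_deriv (ha : 0 < a) (hb : 0 < b) (hc : 0 < c) (hn : 0 < n) {x : ℝ} (hx : 0 ≤ x) (s : ℂ) :
    HasDerivAt (G1 a b c n s) (G2 a b c n s x) x := by
  have h := (dpw_deriv ha hb hc hn hx 1 (s + 1)).const_mul (-s)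
  simp only [pow_one] at h
  refine h.congr_deriv ?_
  simp only [G2, show s + 1 + 1 = s + 2 by ring]
  simp only [Nat.reduceSub, Nat.reduceAdd, pow_zero, pow_one]
  push_cast
  ring

lemma G2_deriv (ha : 0 < a) (hb : 0 < b) (hc : 0 < c) (hn : 0 < n) {x : ℝ} (hx : 0 ≤ x) (s : ℂ) :
    HasDerivAt (G2 a b c n s) (G3 a b c n s x) x := by
  have h := (((pw_deriv ha hb hc hn hx (s + 1)).const_mul (2 * a : ℂ)).fun_sub
    ((dpw_deriv ha hb hc hn hx 2 (s + 2)).const_mul (s + 1))).const_mul (-s)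
  refine h.congr_deriv ?_
  simp only [G3, show s + 1 + 1 = s + 2 by ring, show s + 2 + 1 = s + 3 by ring]
  simp only [Nat.reduceSub, Nat.reduceAdd, pow_zero, pow_one]
  push_cast
  ring

lemma G3_deriv (ha : 0 < a) (hb : 0 < b) (hc : 0 < c) (hn : 0 < n) {x : ℝ} (hx : 0 ≤ x) (s : ℂ) :
    HasDerivAt (G3 a b c n s) (G4 a b c n s x) x := by
  have h := (((dpw_deriv ha hb hc hn hx 1 (s + 2)).const_mul (6 * a : ℂ)).fun_sub
    ((dpw_deriv ha hb hc hn hx 3 (s + 3)).const_mul (s + 2))).const_mul (s * (s + 1))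
  refine h.congr_deriv ?_
  simp only [G4, show s + 2 + 1 = s + 3 by ring, show s + 3 + 1 = s + 4 by ring]
  simp only [Nat.reduceSub, Nat.reduceAdd, pow_zero, pow_one]
  push_cast
  ring

lemma G4_deriv (ha : 0 < a) (hb : 0 < b) (hc : 0 < c) (hn : 0 < n) {x : ℝ} (hx : 0 ≤ x) (s : ℂ) :
    HasDerivAt (G4 a b c n s) (G5 a b c n s x) x := by
  have h := ((((pw_deriv ha hb hc hn hx (s + 2)).const_mul (12 * a ^ 2 : ℂ)).fun_sub
    ((dpw_deriv ha hb hc hn hx 2 (s + 3)).const_mul (12 * a * (s + 2)))).fun_add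
    ((dpw_deriv ha hb hc hn hx 4 (s + 4)).const_mul ((s + 2) * (s + 3)))).const_mul (s * (s + 1))
  refine h.congr_deriv ?_
  simp only [G5, show s + 2 + 1 = s + 3 by ring, show s + 3 + 1 = s + 4 by ring,
    show s + 4 + 1 = s + 5 by ring]
  simp only [Nat.reduceSub, Nat.reduceAdd, pow_zero, pow_one]
  push_cast
  ring

lemma G5_cont (ha : 0 < a) (hb : 0 < b) (hc : 0 < c) (hn : 0 < n) (s : ℂ) : ContinuousOn (G5 a b c n s) (Set.Ici 0) := by
  have h : ∀ (k : ℕ) (z : ℂ), ContinuousOn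
      (fun y => (qd a b n y : ℂ) ^ k * pw (qf a b c n y) z) (Set.Ici 0) := fun k z x hx =>
    (dpw_deriv ha hb hc hn hx k z).continuousAt.continuousWithinAt
  unfold G5
  exact continuousOn_const.mul ((((continuousOn_const).mul (h 1 (s + 3))).add
    ((continuousOn_const).mul (h 3 (s + 4)))).sub ((continuousOn_const).mul (h 5 (s + 5))))

lemma G5_diff (x : ℝ) : Differentiable ℂ (fun s => G5 a b c n s x) := by
  have h : ∀ z : ℂ, Differentiable ℂ (fun s => pw (qf a b c n x) (s + z)) := fun z =>
    (pw_diff _).comp (differentiable_id.add_const z)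
  have h3 := h 3
  have h4 := h 4
  have h5 := h 5
  unfold G5
  fun_prop

/-- the constant bounding the derivative by the square root -/
def kap (a b c : ℝ) : ℝ := Real.sqrt (4 * a + b ^ 2 / c)

lemma qd_le (ha : 0 < a) (hb : 0 < b) (hc : 0 < c) (hn : 0 < n) {x : ℝ} (hx : 0 ≤ x) : qd a b n x ≤ kap a b c * (qf a b c n x) ^ (1 / 2 : ℝ) := by
  rw [← Real.sqrt_eq_rpow, kap, ← Real.sqrt_mul (by positivity)]
  apply Real.le_sqrt_of_sq_le
  have : (4 * a + b ^ 2 / c) * qf a b c n x - qd a b n x ^ 2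
      = b ^ 2 / c * (a * x ^ 2 + b * n * x) + 4 * a * c * n ^ 2 := by
    unfold qf qd
    field_simp
    ring
  have h2 : 0 ≤ b ^ 2 / c * (a * x ^ 2 + b * n * x) + 4 * a * c * n ^ 2 := by positivity
  linarith

lemma kap_nonneg : 0 ≤ kap a b c := Real.sqrt_nonneg _

lemma dpw_bound (ha : 0 < a) (hb : 0 < b) (hc : 0 < c) (hn : 0 < n) {x : ℝ} (hx : 0 ≤ x) (k : ℕ) (z : ℂ) :
    ‖(qd a b n x : ℂ) ^ k * pw (qf a b c n x) z‖
      ≤ kap a b c ^ k * (qf a b c n x) ^ ((k : ℝ) / 2 - z.re) := by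
  have hq := qf_pos ha hb hc hn hx
  have hd := qd_nonneg (n := n) ha hb hn hx
  rw [norm_mul, norm_pow, pw_norm hq, Complex.norm_real, Real.norm_of_nonneg hd]
  calc qd a b n x ^ k * qf a b c n x ^ (-z.re)
      ≤ (kap a b c * (qf a b c n x) ^ (1 / 2 : ℝ)) ^ k * qf a b c n x ^ (-z.re) := by
        gcongr
        exact qd_le ha hb hc hn hx
    _ = _ := by
        rw [mul_pow, ← Real.rpow_natCast (qf a b c n x ^ (1 / 2 : ℝ)), ← Real.rpow_mul hq.le,
          mul_assoc, ← Real.rpow_add hq]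
        congr 2
        ring

/-- the constant in the bound of the fifth derivative -/
def C5 (a b c : ℝ) (s : ℂ) : ℝ :=
  ‖s * (s + 1) * (s + 2)‖ * (60 * a ^ 2 * kap a b c ^ 1 + 20 * a * ‖s + 3‖ * kap a b c ^ 3
    + ‖s + 3‖ * ‖s + 4‖ * kap a b c ^ 5)

lemma G5_bound (ha : 0 < a) (hb : 0 < b) (hc : 0 < c) (hn : 0 < n) {x : ℝ} (hx : 0 ≤ x) (s : ℂ) :
    ‖G5 a b c n s x‖ ≤ C5 a b c s * (qf a b c n x) ^ (-(s.re + 5 / 2)) := by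
  have b1 := dpw_bound ha hb hc hn hx 1 (s + 3)
  have b3 := dpw_bound ha hb hc hn hx 3 (s + 4)
  have b5 := dpw_bound ha hb hc hn hx 5 (s + 5)
  simp only [Complex.add_re, Complex.re_ofNat] at b1 b3 b5
  rw [show ((1 : ℕ) : ℝ) / 2 - (s.re + 3) = -(s.re + 5 / 2) by push_cast; ring] at b1
  rw [show ((3 : ℕ) : ℝ) / 2 - (s.re + 4) = -(s.re + 5 / 2) by push_cast; ring] at b3
  rw [show ((5 : ℕ) : ℝ) / 2 - (s.re + 5) = -(s.re + 5 / 2) by push_cast; ring] at b5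
  rw [G5, norm_mul, C5, mul_assoc ‖s * (s + 1) * (s + 2)‖]
  refine mul_le_mul_of_nonneg_left ?_ (norm_nonneg _)
  refine (norm3_le _ _ _).trans ?_
  rw [add_mul (60 * a ^ 2 * kap a b c ^ 1 + _), add_mul (60 * a ^ 2 * kap a b c ^ 1)]
  refine add_le_add (add_le_add ?_ ?_) ?_
  · rw [norm_mul, mul_assoc (60 * a ^ 2)]
    have : ‖-(60 * (a : ℂ) ^ 2)‖ = 60 * a ^ 2 := by simp [abs_of_pos ha]
    rw [this]
    gcongr
  · rw [norm_mul, mul_assoc (20 * a * _)]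
    have : ‖20 * (a : ℂ) * (s + 3)‖ = 20 * a * ‖s + 3‖ := by simp [abs_of_pos ha]
    rw [this]
    gcongr
  · rw [norm_mul, norm_mul, mul_assoc (‖s + 3‖ * _)]
    gcongr

end quad

section rem

variable {a b c : ℝ}

/-- the Euler-Maclaurin remainder at `(m, j+1)` -/
def Rm (a b c : ℝ) (p : ℕ × ℕ) (s : ℂ) : ℂ :=
  ∫ x in (0 : ℝ)..1, (P5 x : ℂ) * G5 a b c ((p.1 : ℝ) + 1) s ((p.2 : ℝ) + x)

lemma qf_lower (ha : 0 < a) (hb : 0 < b) (hc : 0 < c) (j m : ℕ) {x : ℝ} (hx : 0 ≤ x) :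
    min b c * ((j + 1 : ℝ) * (m + 1)) ≤ qf a b c ((j : ℝ) + 1) ((m : ℝ) + x) := by
  have h1 : min b c ≤ b := min_le_left _ _
  have h2 : min b c ≤ c := min_le_right _ _
  have h0 : 0 < min b c := lt_min hb hc
  have hj : (0 : ℝ) ≤ j := Nat.cast_nonneg j
  have hm : (0 : ℝ) ≤ m := Nat.cast_nonneg m
  unfold qf
  calc min b c * ((j + 1 : ℝ) * (m + 1)) = min b c * (j + 1) * m + min b c * (j + 1) := by ring
    _ ≤ b * (j + 1) * (m + x) + c * (j + 1) ^ 2 := by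
        refine add_le_add ?_ ?_
        · gcongr; linarith
        · rw [pow_two, ← mul_assoc]
          have : min b c * ((j : ℝ) + 1) ≤ c * (j + 1) := by gcongr
          nlinarith [mul_nonneg (mul_nonneg hc.le (by linarith : (0 : ℝ) ≤ j + 1)) hj]
    _ ≤ _ := by
        have : 0 ≤ a * (m + x) ^ 2 := by positivity
        linarith

/-- combined constant -/
def C6 (a b c : ℝ) (s : ℂ) : ℝ := C5 a b c s * (min b c) ^ (-(s.re + 5 / 2))

lemma kap_nonneg' : 0 ≤ kap a b c := Real.sqrt_nonneg _

lemma C5_nonneg (ha : 0 < a) (s : ℂ) : 0 ≤ C5 a b c s := by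
  have := kap_nonneg' (a := a) (b := b) (c := c)
  unfold C5; positivity

lemma C6_nonneg (ha : 0 < a) (hb : 0 < b) (hc : 0 < c) (s : ℂ) : 0 ≤ C6 a b c s := by
  have := C5_nonneg (b := b) (c := c) ha s
  have := lt_min hb hc
  unfold C6; positivity

lemma C6_cont (hb : 0 < b) (hc : 0 < c) : Continuous (C6 a b c) := by
  have h := lt_min hb hc
  have : Continuous fun s : ℂ => (min b c) ^ (-(s.re + 5 / 2)) :=
    Continuous.rpow continuous_const (by fun_prop) (fun _ => Or.inl h.ne')
  unfold C6 C5
  fun_prop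

lemma G5_bound' (ha : 0 < a) (hb : 0 < b) (hc : 0 < c) (p : ℕ × ℕ) {x : ℝ} (hx : 0 ≤ x) {s : ℂ}
    (hs : -(3 / 2) < s.re) :
    ‖G5 a b c ((p.1 : ℝ) + 1) s ((p.2 : ℝ) + x)‖
      ≤ C6 a b c s * (((p.1 + 1 : ℝ) * (p.2 + 1)) ^ (-(s.re + 5 / 2))) := by
  have h0 := lt_min hb hc
  have := G5_bound ha hb hc (n := (p.1 : ℝ) + 1) (by positivity) (x := (p.2 : ℝ) + x)
    (by positivity) s
  refine this.trans ?_
  rw [C6, mul_assoc, ← Real.mul_rpow h0.le (by positivity)]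
  refine mul_le_mul_of_nonneg_left ?_ (C5_nonneg ha s)
  exact Real.rpow_le_rpow_of_nonpos (by positivity) (qf_lower ha hb hc p.1 p.2 hx) (by linarith)

lemma PG_bound (ha : 0 < a) (hb : 0 < b) (hc : 0 < c) (p : ℕ × ℕ) {x : ℝ}
    (hx : x ∈ Set.Icc (0 : ℝ) 1) {s : ℂ} (hs : -(3 / 2) < s.re) :
    ‖(P5 x : ℂ) * G5 a b c ((p.1 : ℝ) + 1) s ((p.2 : ℝ) + x)‖
      ≤ C6 a b c s * (((p.1 + 1 : ℝ) * (p.2 + 1)) ^ (-(s.re + 5 / 2))) := by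
  rw [norm_mul, Complex.norm_real, Real.norm_eq_abs]
  calc _ ≤ 1 * ‖G5 a b c ((p.1 : ℝ) + 1) s ((p.2 : ℝ) + x)‖ := by
        gcongr; exact P5_bound hx
    _ ≤ _ := by rw [one_mul]; exact G5_bound' ha hb hc p hx.1 hs

lemma Rm_bound (ha : 0 < a) (hb : 0 < b) (hc : 0 < c) (p : ℕ × ℕ) {s : ℂ}
    (hs : -(3 / 2) < s.re) :
    ‖Rm a b c p s‖ ≤ C6 a b c s * (((p.1 + 1 : ℝ) * (p.2 + 1)) ^ (-(s.re + 5 / 2))) := by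
  have := intervalIntegral.norm_integral_le_of_norm_le_const (a := (0 : ℝ)) (b := 1)
    (f := fun x => (P5 x : ℂ) * G5 a b c ((p.1 : ℝ) + 1) s ((p.2 : ℝ) + x))
    (C := C6 a b c s * (((p.1 + 1 : ℝ) * (p.2 + 1)) ^ (-(s.re + 5 / 2)))) (fun x hx => by
      rw [Set.uIoc_of_le (by norm_num)] at hx
      exact PG_bound ha hb hc p ⟨hx.1.le, hx.2⟩ hs)
  simpa [Rm] using this

lemma summ2 {p : ℝ} (hp : 1 < p) :
    Summable (fun q : ℕ × ℕ => ((q.1 + 1 : ℝ) * (q.2 + 1)) ^ (-p)) := by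
  have h : Summable (fun n : ℕ => ((n : ℝ) + 1) ^ (-p)) := by
    have := (summable_nat_add_iff 1).2 (Real.summable_nat_rpow.2 (by linarith : -p < -1))
    simpa using this
  have := Summable.mul_of_nonneg h h (fun n => by positivity) (fun n => by positivity)
  refine this.congr fun q => ?_
  rw [Real.mul_rpow (by positivity) (by positivity)]

lemma Rm_summable (ha : 0 < a) (hb : 0 < b) (hc : 0 < c) {s : ℂ} (hs : -(3 / 2) < s.re) :
    Summable (fun p => Rm a b c p s) := by
  refine Summable.of_norm_bounded ((summ2 (p := s.re + 5 / 2) (by linarith)).mul_left (C6 a b c s)) ?_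
  exact fun p => Rm_bound ha hb hc p hs

lemma isOpen_re (t : ℝ) : IsOpen {s : ℂ | t < s.re} := isOpen_lt continuous_const Complex.continuous_re

/-- local uniform bound -/
lemma local_bound (ha : 0 < a) (hb : 0 < b) (hc : 0 < c) {s₀ : ℂ} (hs : -(3 / 2) < s₀.re) :
    ∃ V ∈ 𝓝 s₀, ∃ B : ℝ, ∃ p : ℝ, 1 < p ∧ 0 ≤ B ∧ IsOpen V ∧ ∀ s ∈ V, -(3 / 2) < s.re ∧
      C6 a b c s ≤ B ∧ p ≤ s.re + 5 / 2 := by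
  have hp : 1 < ((s₀.re + 5 / 2) + 1) / 2 := by linarith
  have h1 : {s : ℂ | C6 a b c s < C6 a b c s₀ + 1} ∩ {s : ℂ | ((s₀.re + 5 / 2) + 1) / 2 - 5 / 2 < s.re}
    ∈ 𝓝 s₀ := by
    refine Filter.inter_mem ?_ ?_
    · exact (isOpen_lt (C6_cont hb hc) continuous_const).mem_nhds (by simp)
    · exact (isOpen_re _).mem_nhds (by simp only [Set.mem_ofPred_eq]; linarith)
  refine ⟨_, h1, C6 a b c s₀ + 1, _, hp, ?_, ?_, ?_⟩
  · linarith [C6_nonneg ha hb hc s₀]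
  · exact (isOpen_lt (C6_cont hb hc) continuous_const).inter (isOpen_re _)
  · rintro s ⟨h1, h2⟩
    simp only [Set.mem_ofPred_eq] at h1 h2
    exact ⟨by linarith, h1.le, by linarith⟩

lemma bound_mono {B C p p' : ℝ} (q : ℕ × ℕ) (hC : C ≤ B) (hB : 0 ≤ B) (hp : p ≤ p') :
    C * (((q.1 + 1 : ℝ) * (q.2 + 1)) ^ (-p')) ≤ B * (((q.1 + 1 : ℝ) * (q.2 + 1)) ^ (-p)) := by
  have h1 : (1 : ℝ) ≤ (q.1 + 1 : ℝ) * (q.2 + 1) := by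
    have : (0 : ℝ) ≤ q.1 := Nat.cast_nonneg _
    have : (0 : ℝ) ≤ q.2 := Nat.cast_nonneg _
    nlinarith
  have := Real.rpow_le_rpow_of_exponent_le h1 (by linarith : -p' ≤ -p)
  gcongr

lemma Rm_diff (ha : 0 < a) (hb : 0 < b) (hc : 0 < c) (p : ℕ × ℕ) :
    DifferentiableOn ℂ (Rm a b c p) {s | -(3 / 2) < s.re} := by
  have := hol_integral (μ := volume.restrict (Set.Ioc (0 : ℝ) 1)) (isOpen_re (-(3 / 2)))
    (fun s x => (P5 x : ℂ) * G5 a b c ((p.1 : ℝ) + 1) s ((p.2 : ℝ) + x)) ?_ ?_ ?_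
  · refine this.congr fun s hs => ?_
    rw [Rm, intervalIntegral.integral_of_le (by norm_num)]
  · intro s hs
    refine ContinuousOn.aestronglyMeasurable ?_ measurableSet_Ioc
    refine (Complex.continuous_ofReal.comp P5_cont).continuousOn.mul ?_
    refine (G5_cont ha hb hc (by positivity) s).comp (by fun_prop) ?_
    intro x hx
    have := hx.1
    simp only [Set.mem_Ici]
    positivity
  · refine Filter.Eventually.of_forall fun x => ?_
    exact ((G5_diff _).const_mul _).differentiableOn
  · intro s₀ hs₀
    obtain ⟨V, hV, B, e, he, hB, -, h⟩ := local_bound ha hb hc hs₀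
    refine ⟨V, hV, fun _ => B * (((p.1 + 1 : ℝ) * (p.2 + 1)) ^ (-e)), ?_, ?_⟩
    · exact integrable_const _
    · refine (ae_restrict_iff' measurableSet_Ioc).2 (Filter.Eventually.of_forall fun x hx s hs => ?_)
      obtain ⟨h1, h2, h3⟩ := h s hs
      exact (PG_bound ha hb hc p ⟨hx.1.le, hx.2⟩ h1).trans (bound_mono p h2 hB h3)

/-- total remainder -/
def Rs (a b c : ℝ) (s : ℂ) : ℂ := ∑' p : ℕ × ℕ, Rm a b c p s

lemma Rs_diff (ha : 0 < a) (hb : 0 < b) (hc : 0 < c) :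
    DifferentiableOn ℂ (Rs a b c) {s | -(3 / 2) < s.re} := by
  intro s₀ hs₀
  obtain ⟨V, hV, B, e, he, hB, hVo, h⟩ := local_bound ha hb hc hs₀
  have := Complex.differentiableOn_tsum_of_summable_norm (F := fun p s => Rm a b c p s) (U := V)
    ((summ2 he).mul_left B)
    (fun p => (Rm_diff ha hb hc p).mono fun s hs => (h s hs).1) hVo
    (fun p s hs => (Rm_bound ha hb hc p (h s hs).1).trans (bound_mono p (h s hs).2.1 hB (h s hs).2.2))
  exact ((this s₀ (mem_of_mem_nhds hV)).differentiableAt hV).differentiableWithinAt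

lemma Rs_neg_one : Rs a b c (-1) = 0 := by
  have : ∀ p, Rm a b c p (-1) = 0 := by
    intro p
    simp [Rm, G5]
  simp [Rs, this]

end rem

section integ

variable {a b c n : ℝ}

/-- the constant in the lower bound -/
def nu (a b c : ℝ) : ℝ := min (min a (b / 2)) c

lemma nu_pos (ha : 0 < a) (hb : 0 < b) (hc : 0 < c) : 0 < nu a b c :=
  lt_min (lt_min ha (by positivity)) hc

lemma qf_lower2 (ha : 0 < a) (hb : 0 < b) (hc : 0 < c) (hn : 0 < n) {x : ℝ} (hx : 0 ≤ x) :
    nu a b c * (x + n) ^ 2 ≤ qf a b c n x := by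
  have h0 := nu_pos ha hb hc
  have h1 : nu a b c ≤ a := (min_le_left _ _).trans (min_le_left _ _)
  have h2 : nu a b c ≤ b / 2 := (min_le_left _ _).trans (min_le_right _ _)
  have h3 : nu a b c ≤ c := min_le_right _ _
  unfold qf
  have e1 : nu a b c * x ^ 2 ≤ a * x ^ 2 := by gcongr
  have e2 : nu a b c * (2 * (n * x)) ≤ b / 2 * (2 * (n * x)) := by gcongr
  have e3 : nu a b c * n ^ 2 ≤ c * n ^ 2 := by gcongr
  nlinarith

lemma G0_bound (ha : 0 < a) (hb : 0 < b) (hc : 0 < c) (hn : 0 < n) {x : ℝ} (hx : 0 ≤ x) {s : ℂ}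
    (hs : 1 / 2 < s.re) :
    ‖G0 a b c n s x‖ ≤ nu a b c ^ (-s.re) * (x + n) ^ (-2 * s.re) := by
  have h0 := nu_pos ha hb hc
  rw [G0, pw_norm (qf_pos ha hb hc hn hx)]
  have : (x + n) ^ (-2 * s.re) = ((x + n) ^ 2) ^ (-s.re) := by
    rw [← Real.rpow_natCast, ← Real.rpow_mul (by positivity)]
    congr 1
    push_cast
    ring
  rw [this, ← Real.mul_rpow h0.le (by positivity)]
  exact Real.rpow_le_rpow_of_nonpos (by positivity) (qf_lower2 ha hb hc hn hx) (by linarith)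

lemma G0_meas (ha : 0 < a) (hb : 0 < b) (hc : 0 < c) (hn : 0 < n) (s : ℂ) :
    AEStronglyMeasurable (G0 a b c n s) (volume.restrict (Set.Ioi 0)) := by
  refine ContinuousOn.aestronglyMeasurable (fun x hx => ?_) measurableSet_Ioi
  exact (G0_deriv ha hb hc hn (le_of_lt hx) s).continuousAt.continuousWithinAt

lemma G0_int (ha : 0 < a) (hb : 0 < b) (hc : 0 < c) (hn : 0 < n) {s : ℂ}
    (hs : 1 / 2 < s.re) : IntegrableOn (G0 a b c n s) (Set.Ioi 0) := by
  refine Integrable.mono' (g := fun x => nu a b c ^ (-s.re) * (x + n) ^ (-2 * s.re)) ?_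
    (G0_meas ha hb hc hn s) ?_
  · exact (integrableOn_add_rpow_Ioi_of_lt (by linarith) (by linarith)).const_mul _
  · refine (ae_restrict_iff' measurableSet_Ioi).2 (Filter.Eventually.of_forall fun x hx => ?_)
    exact G0_bound ha hb hc hn (le_of_lt hx) hs

/-- the integral -/
def Ic (a b c : ℝ) (s : ℂ) : ℂ := ∫ x in Set.Ioi (0 : ℝ), G0 a b c 1 s x

lemma Ic_diff (ha : 0 < a) (hb : 0 < b) (hc : 0 < c) :
    DifferentiableOn ℂ (Ic a b c) {s | 1 / 2 < s.re} := by
  refine hol_integral (isOpen_re _) _ (fun s hs => G0_meas ha hb hc one_pos s) ?_ ?_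
  · exact Filter.Eventually.of_forall fun x => (pw_diff _).differentiableOn
  · intro s₀ hs₀
    simp only [Set.mem_ofPred_eq] at hs₀
    have h0 := nu_pos ha hb hc
    have hcont : Continuous fun s : ℂ => nu a b c ^ (-s.re) :=
      Continuous.rpow continuous_const (by fun_prop) (fun _ => Or.inl h0.ne')
    refine ⟨{s : ℂ | nu a b c ^ (-s.re) < nu a b c ^ (-s₀.re) + 1} ∩ {s : ℂ | (s₀.re + 1 / 2) / 2 < s.re},
      Filter.inter_mem ?_ ?_, fun x => (nu a b c ^ (-s₀.re) + 1) * (x + 1) ^ (-2 * ((s₀.re + 1 / 2) / 2)),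
      ?_, ?_⟩
    · exact (isOpen_lt hcont continuous_const).mem_nhds (by simp)
    · exact (isOpen_re _).mem_nhds (by simp only [Set.mem_ofPred_eq]; linarith)
    · exact (integrableOn_add_rpow_Ioi_of_lt (by linarith) (by linarith)).const_mul _
    · refine (ae_restrict_iff' measurableSet_Ioi).2 (Filter.Eventually.of_forall fun x hx s hs => ?_)
      obtain ⟨h1, h2⟩ := hs
      simp only [Set.mem_ofPred_eq] at h1 h2
      have hx' : (0 : ℝ) < x := hx
      refine (G0_bound ha hb hc one_pos (le_of_lt hx) (by linarith)).trans ?_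
      have : (x + 1) ^ (-2 * s.re) ≤ (x + 1) ^ (-2 * ((s₀.re + 1 / 2) / 2)) :=
        Real.rpow_le_rpow_of_exponent_le (by linarith) (by linarith)
      have h3 : 0 ≤ nu a b c ^ (-s₀.re) := by positivity
      exact mul_le_mul h1.le this (by positivity) (by linarith)

lemma qf_tendsto (ha : 0 < a) (hb : 0 < b) (hc : 0 < c) (hn : 0 < n) :
    Tendsto (qf a b c n) atTop atTop := by
  refine tendsto_atTop_mono' atTop (f₁ := fun x => b * n * x) ?_ ?_
  · filter_upwards with x
    unfold qf
    have : 0 ≤ a * x ^ 2 + c * n ^ 2 := by positivity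
    linarith
  · exact tendsto_id.const_mul_atTop (by positivity)

lemma dpw_tendsto (ha : 0 < a) (hb : 0 < b) (hc : 0 < c) (hn : 0 < n) (k : ℕ) {z : ℂ}
    (hz : (k : ℝ) / 2 < z.re) :
    Tendsto (fun x => (qd a b n x : ℂ) ^ k * pw (qf a b c n x) z) atTop (𝓝 0) := by
  have h1 : Tendsto (fun x => kap a b c ^ k * (qf a b c n x) ^ ((k : ℝ) / 2 - z.re)) atTop (𝓝 0) := by
    have := (tendsto_rpow_neg_atTop (y := z.re - k / 2) (by linarith)).comp (qf_tendsto ha hb hc hn)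
    simpa using this.const_mul (kap a b c ^ k)
  refine squeeze_zero_norm' ?_ h1
  filter_upwards [eventually_ge_atTop 0] with x hx using dpw_bound ha hb hc hn hx k z

lemma Ic_rec (ha : 0 < a) (hb : 0 < b) (hc : 0 < c) {s : ℂ} (hs : 1 / 2 < s.re) :
    2 * a * (1 - 2 * s) * Ic a b c s = s * (b ^ 2 - 4 * a * c) * Ic a b c (s + 1) - b * pw c s := by
  have hs1 : 1 / 2 < (s + 1).re := by simp; linarith
  have i0 := G0_int ha hb hc one_pos hs
  have i1 := G0_int ha hb hc one_pos hs1
  have key := integral_Ioi_of_hasDerivAt_of_tendsto (a := 0) (m := 0)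
    (f := fun x => (qd a b 1 x : ℂ) ^ 1 * pw (qf a b c 1 x) s)
    (f' := fun x => 2 * a * (1 - 2 * s) * G0 a b c 1 s x
      - s * (b ^ 2 - 4 * a * c) * G0 a b c 1 (s + 1) x) ?_ ?_ ?_ ?_
  · rw [integral_sub (i0.const_mul _) (i1.const_mul _), integral_const_mul, integral_const_mul] at key
    change 2 * a * (1 - 2 * s) * Ic a b c s - s * (b ^ 2 - 4 * a * c) * Ic a b c (s + 1) = _ at key
    simp [qd, qf] at key
    linear_combination key
  · exact (dpw_deriv ha hb hc one_pos le_rfl 1 s).continuousAt.continuousWithinAt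
  · intro x hx
    refine (dpw_deriv ha hb hc one_pos (le_of_lt hx) 1 s).congr_deriv ?_
    simp only [G0]
    rw [pw_add_one (qf_pos ha hb hc one_pos (le_of_lt hx)) s]
    simp only [qd, qf]
    push_cast
    ring
  · exact (i0.const_mul _).sub (i1.const_mul _)
  · exact dpw_tendsto ha hb hc one_pos 1 (by simpa using hs)

/-- continuation of `Ic` -/
def Ict (a b c : ℝ) (s : ℂ) : ℂ :=
  (s * (b ^ 2 - 4 * a * c) * (((s + 1) * (b ^ 2 - 4 * a * c) * Ic a b c (s + 2) - b * pw c (s + 1)) /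
    (2 * a * (-1 - 2 * s))) - b * pw c s) / (2 * a * (1 - 2 * s))

lemma Ict_eq (ha : 0 < a) (hb : 0 < b) (hc : 0 < c) {s : ℂ} (hs : 1 < s.re) :
    Ict a b c s = Ic a b c s := by
  have ha' : (a : ℂ) ≠ 0 := by exact_mod_cast ha.ne'
  have h1 := Ic_rec ha hb hc (s := s) (by linarith)
  have h2 := Ic_rec ha hb hc (s := s + 1) (by simp; linarith)
  rw [show s + 1 + 1 = s + 2 by ring] at h2
  have n1 : (1 - 2 * s) ≠ 0 := by
    intro h
    have := congrArg Complex.re h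
    simp at this
    linarith
  have n2 : (-1 - 2 * s) ≠ 0 := by
    intro h
    have := congrArg Complex.re h
    simp at this
    linarith
  rw [Ict, ← h2, show (2 * (a : ℂ) * (1 - 2 * (s + 1)) * Ic a b c (s + 1)) / (2 * a * (-1 - 2 * s))
    = Ic a b c (s + 1) by field_simp; ring, ← h1]
  field_simp

lemma Ict_neg_one (ha : 0 < a) (hc : 0 < c) :
    Ict a b c (-1) = ((b ^ 3 - 6 * a * b * c) / (12 * a ^ 2) : ℝ) := by
  have ha' : (a : ℂ) ≠ 0 := by exact_mod_cast ha.ne'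
  rw [Ict, pw_neg_one hc, show (-1 : ℂ) + 1 = 0 by ring, pw_zero]
  push_cast
  field_simp
  ring

lemma Gn_int (ha : 0 < a) (hb : 0 < b) (hc : 0 < c) (hn : 0 < n) (s : ℂ) :
    ∫ x in Set.Ioi (0 : ℝ), G0 a b c n s x = n * pw (n ^ 2) s * Ic a b c s := by
  have h := integral_comp_mul_left_Ioi (fun x => G0 a b c n s x) 0 hn
  rw [mul_zero] at h
  have h2 : ∫ x in Set.Ioi (0 : ℝ), G0 a b c n s (n * x) = pw (n ^ 2) s * Ic a b c s := by
    rw [Ic, ← integral_const_mul]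
    refine setIntegral_congr_fun measurableSet_Ioi fun x hx => ?_
    simp only [G0]
    rw [← pw_mul (by positivity) (qf_pos ha hb hc one_pos (le_of_lt hx))]
    congr 1
    unfold qf
    ring
  rw [h2] at h
  rw [mul_assoc, h, Complex.real_smul, ← mul_assoc]
  push_cast
  rw [mul_inv_cancel₀ (by exact_mod_cast hn.ne'), one_mul]

end integ

section cone

variable {a b c : ℝ}

/-- `(w - 1) ζ(w)` with the singularity removed -/
def zs : ℂ → ℂ := Function.update (fun w => (w - 1) * riemannZeta w) 1 1

lemma zs_one : zs 1 = 1 := by simp [zs]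

lemma zs_of_ne {w : ℂ} (h : w ≠ 1) : zs w = (w - 1) * riemannZeta w := by simp [zs, h]

lemma zs_diff : Differentiable ℂ zs := by
  rw [← differentiableOn_univ,
    ← Complex.differentiableOn_compl_singleton_and_continuousAt_iff (c := 1) Filter.univ_mem]
  refine ⟨?_, ?_⟩
  · intro w hw
    have hw1 : w ≠ 1 := hw.2
    have hd : DifferentiableAt ℂ (fun w => (w - 1) * riemannZeta w) w :=
      (differentiableAt_id.sub_const 1).mul (differentiableAt_riemannZeta hw1)
    refine (hd.congr_of_eventuallyEq ?_).differentiableWithinAt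
    filter_upwards [isOpen_ne.mem_nhds hw1] with z hz using zs_of_ne hz
  · exact continuousAt_update_same.2 riemannZeta_residue_one

lemma zsum (k : ℕ) {z : ℂ} (hz : 1 < 2 * z.re - k) :
    HasSum (fun j : ℕ => ((j : ℂ) + 1) ^ k * pw (((j : ℝ) + 1) ^ 2) z) (riemannZeta (2 * z - k)) := by
  have hre : 1 < (2 * z - k).re := by simpa using hz
  have hs : Summable (fun n : ℕ => 1 / (n : ℂ) ^ (2 * z - k)) := Complex.summable_one_div_nat_cpow.2 hre
  have hs1 := (summable_nat_add_iff 1).2 hs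
  have h := hs1.hasSum
  have e : ∑' n : ℕ, 1 / ((n + 1 : ℕ) : ℂ) ^ (2 * z - k) = riemannZeta (2 * z - k) := by
    rw [zeta_eq_tsum_one_div_nat_add_one_cpow hre]
    push_cast
    rfl
  rw [e] at h
  refine h.congr_fun ?_ |> fun h => h
  intro j
  have hj : ((j + 1 : ℕ) : ℂ) ≠ 0 := by exact_mod_cast Nat.succ_ne_zero j
  have := pw_cpow (Nat.succ_pos j) z
  push_cast at this hj ⊢
  rw [this, Complex.cpow_sub _ _ hj, Complex.cpow_natCast]
  field_simp

/-- the weights -/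
def W (p : ℕ × ℕ) : ℝ :=
  if p.1 = 0 ∧ p.2 = 0 then 0 else if p.1 = 0 ∨ p.2 = 0 then 1 / 2 else 1

lemma W_bound (p : ℕ × ℕ) : |W p| ≤ 1 := by
  unfold W
  split_ifs <;> norm_num

/-- unweighted summand, zero at origin -/
def Tm (a b c : ℝ) (s : ℂ) (p : ℕ × ℕ) : ℂ :=
  if p = 0 then 0 else G0 a b c p.1 s p.2

lemma Tm_summable (ha : 0 < a) (hb : 0 < b) (hc : 0 < c) {s : ℂ} (hs : 1 < s.re) :
    Summable (Tm a b c s) := by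
  set κ := min b (min (a / 2) (c / 2)) with hκ
  have h0 : 0 < κ := lt_min hb (lt_min (by positivity) (by positivity))
  have h1 : κ ≤ b := min_le_left _ _
  have h2 : κ ≤ a / 2 := (min_le_right _ _).trans (min_le_left _ _)
  have h3 : κ ≤ c / 2 := (min_le_right _ _).trans (min_le_right _ _)
  refine Summable.of_norm_bounded ((summ2 hs).mul_left (κ ^ (-s.re))) ?_
  rintro ⟨n, m⟩
  by_cases hp : ((n, m) : ℕ × ℕ) = 0
  · rw [Tm, if_pos hp, norm_zero]; positivity
  rw [Tm, if_neg hp]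
  simp only
  have hlow : κ * (((n : ℝ) + 1) * (m + 1)) ≤ qf a b c n m := by
    have en : (n : ℝ) ≤ (n : ℝ) ^ 2 := by
      exact_mod_cast Nat.le_self_pow (by norm_num) n
    have em : (m : ℝ) ≤ (m : ℝ) ^ 2 := by
      exact_mod_cast Nat.le_self_pow (by norm_num) m
    have e1 : (1 : ℝ) ≤ n + m := by
      have : 1 ≤ n + m := by
        rcases Nat.eq_zero_or_pos (n + m) with h | h
        · exfalso; apply hp
          have : n = 0 ∧ m = 0 := by omega
          simp [this]
        · exact h
      exact_mod_cast this
    have hn : (0 : ℝ) ≤ n := Nat.cast_nonneg _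
    have hm : (0 : ℝ) ≤ m := Nat.cast_nonneg _
    calc κ * (((n : ℝ) + 1) * (m + 1)) ≤ κ * (2 * m ^ 2 + n * m + 2 * n ^ 2) := by
          gcongr; nlinarith
      _ = (2 * κ) * m ^ 2 + κ * (n * m) + (2 * κ) * n ^ 2 := by ring
      _ ≤ a * m ^ 2 + b * (n * m) + c * n ^ 2 := by gcongr <;> linarith
      _ = _ := by unfold qf; ring
  rw [G0, pw_norm (lt_of_lt_of_le (by positivity) hlow), ← Real.mul_rpow h0.le (by positivity)]
  exact Real.rpow_le_rpow_of_nonpos (by positivity) hlow (by linarith)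

lemma WTm_summable (ha : 0 < a) (hb : 0 < b) (hc : 0 < c) {s : ℂ} (hs : 1 < s.re) :
    Summable (fun p => (W p : ℂ) * Tm a b c s p) := by
  refine Summable.of_norm_bounded (Tm_summable ha hb hc hs).norm fun p => ?_
  rw [norm_mul, Complex.norm_real]
  calc _ ≤ 1 * ‖Tm a b c s p‖ := by gcongr; exact W_bound p
    _ = _ := one_mul _

/-- the zeta function of a cone -/
def Ez (a b c : ℝ) (s : ℂ) : ℂ :=
  pw a s / 2 * riemannZeta (2 * s) + Ict a b c s * riemannZeta (2 * s - 1)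
    + s * b * pw c (s + 1) / 12 * riemannZeta (2 * s + 1)
    + s / 720 * (6 * a * b * pw c (s + 2) - (s + 2) * b ^ 3 * pw c (s + 3)) * (zs (2 * s + 3) / 2)
    + Rs a b c s

lemma row_zero (ha : 0 < a) {s : ℂ} (hs : 1 < s.re) :
    ∑' m : ℕ, (W (0, m) : ℂ) * Tm a b c s (0, m) = pw a s / 2 * riemannZeta (2 * s) := by
  have h := (zsum 0 (z := s) (by simp; linarith)).mul_left (pw a s / 2)
  have h2 : HasSum (fun m : ℕ => (W (0, m) : ℂ) * Tm a b c s (0, m))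
      (pw a s / 2 * riemannZeta (2 * s)) := by
    rw [← hasSum_nat_add_iff' 1]
    simp only [Finset.range_one, Finset.sum_singleton]
    have e0 : (W (0, 0) : ℂ) * Tm a b c s (0, 0) = 0 := by simp [W]
    rw [e0, sub_zero]
    simp only [pow_zero, one_mul, Nat.cast_zero, sub_zero] at h
    refine h.congr_fun ?_ |> fun h => h
    intro m
    rw [Tm, if_neg (by simp), G0, div_mul_eq_mul_div, ← pw_mul ha (by positivity)]
    simp [W, qf]
    ring
  exact h2.tsum_eq

lemma row_succ (ha : 0 < a) (hb : 0 < b) (hc : 0 < c) {s : ℂ} (hs : 1 < s.re) (j : ℕ) :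
    ∑' m : ℕ, (W (j + 1, m) : ℂ) * Tm a b c s (j + 1, m) =
      Ict a b c s * (((j : ℂ) + 1) ^ 1 * pw (((j : ℝ) + 1) ^ 2) s)
      + s * b * pw c (s + 1) / 12 * (((j : ℂ) + 1) ^ 1 * pw (((j : ℝ) + 1) ^ 2) (s + 1))
      + s / 720 * (6 * a * b * pw c (s + 2)) * (s + 1) *
        (((j : ℂ) + 1) ^ 1 * pw (((j : ℝ) + 1) ^ 2) (s + 2))
      - s / 720 * ((s + 2) * b ^ 3 * pw c (s + 3)) * (s + 1) *
        (((j : ℂ) + 1) ^ 3 * pw (((j : ℝ) + 1) ^ 2) (s + 3))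
      + ∑' m, Rm a b c (j, m) s := by
  have hn : (0 : ℝ) < (j : ℝ) + 1 := by positivity
  have hrow : Summable (fun m : ℕ => G0 a b c ((j : ℝ) + 1) s m) := by
    have := (Tm_summable ha hb hc hs).prod_factor (j + 1)
    refine this.congr fun m => ?_
    rw [Tm, if_neg (by simp)]
    push_cast
    rfl
  have h := em_full (G0 a b c ((j : ℝ) + 1) s) _ _ _ _ _
    (fun x hx => G0_deriv ha hb hc hn hx s) (fun x hx => G1_deriv ha hb hc hn hx s)
    (fun x hx => G2_deriv ha hb hc hn hx s) (fun x hx => G3_deriv ha hb hc hn hx s)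
    (fun x hx => G4_deriv ha hb hc hn hx s) (G5_cont ha hb hc hn s)
    (G0_int ha hb hc hn (by linarith)) hrow
    ((Rm_summable ha hb hc (by linarith : -(3 / 2) < s.re)).prod_factor j) ?_ ?_
  · have hW : ∑' m : ℕ, (W (j + 1, m) : ℂ) * Tm a b c s (j + 1, m)
        = (∑' m : ℕ, G0 a b c ((j : ℝ) + 1) s m) - G0 a b c ((j : ℝ) + 1) s 0 / 2 := by
      have hsum := ((WTm_summable ha hb hc hs).prod_factor (j + 1))
      rw [hsum.tsum_eq_zero_add, hrow.tsum_eq_zero_add]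
      have : ∀ m : ℕ, (W (j + 1, m + 1) : ℂ) * Tm a b c s (j + 1, m + 1)
          = G0 a b c ((j : ℝ) + 1) s (m + 1 : ℕ) := by
        intro m
        rw [Tm, if_neg (by simp)]
        simp [W]
      simp only [this]
      rw [Tm, if_neg (by simp)]
      simp [W]
      ring
    rw [hW, h, Gn_int ha hb hc hn s, ← Ict_eq ha hb hc hs]
    have c1 := pw_mul hc (q := ((j : ℝ) + 1) ^ 2) (by positivity) (s + 1)
    have c2 := pw_mul hc (q := ((j : ℝ) + 1) ^ 2) (by positivity) (s + 2)
    have c3 := pw_mul hc (q := ((j : ℝ) + 1) ^ 2) (by positivity) (s + 3)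
    simp only [G1, G3, qd, qf, Rm, mul_zero, zero_add, ne_eq, OfNat.ofNat_ne_zero,
      not_false_eq_true, zero_pow, c1, c2, c3]
    push_cast
    ring
  · have := (dpw_tendsto ha hb hc hn 1 (z := s + 1) (by simp; linarith)).comp
      (tendsto_natCast_atTop_atTop (R := ℝ))
    simpa [G1, Function.comp_def] using this.const_mul (-s)
  · have t1 := (dpw_tendsto ha hb hc hn 1 (z := s + 2) (by simp; linarith)).comp
      (tendsto_natCast_atTop_atTop (R := ℝ))
    have t3 := (dpw_tendsto ha hb hc hn 3 (z := s + 3) (by simp; linarith)).comp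
      (tendsto_natCast_atTop_atTop (R := ℝ))
    have := ((t1.const_mul (6 * a : ℂ)).sub (t3.const_mul (s + 2))).const_mul (s * (s + 1))
    simpa only [G3, Function.comp_def, mul_zero, sub_zero] using this

lemma cone_hasSum (ha : 0 < a) (hb : 0 < b) (hc : 0 < c) {s : ℂ} (hs : 1 < s.re) :
    HasSum (fun p => (W p : ℂ) * Tm a b c s p) (Ez a b c s) := by
  have hsum := WTm_summable ha hb hc hs
  have hR := Rm_summable ha hb hc (by linarith : -(3 / 2) < s.re)
  have key : ∑' p, (W p : ℂ) * Tm a b c s p = Ez a b c s := by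
    rw [hsum.tsum_prod, hsum.prod.tsum_eq_zero_add, row_zero ha hs]
    have z1 := (zsum 1 (z := s) (by simp; linarith)).mul_left (Ict a b c s)
    have z2 := (zsum 1 (z := s + 1) (by simp; linarith)).mul_left (s * b * pw c (s + 1) / 12)
    have z3 := (zsum 1 (z := s + 2) (by simp; linarith)).mul_left
      (s / 720 * (6 * a * b * pw c (s + 2)) * (s + 1))
    have z4 := (zsum 3 (z := s + 3) (by simp; linarith)).mul_left
      (s / 720 * ((s + 2) * b ^ 3 * pw c (s + 3)) * (s + 1))
    have z5 := hR.prod.hasSum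
    have z := ((((z1.add z2).add z3).sub z4).add z5).tsum_eq
    simp only [row_succ ha hb hc hs]
    rw [z, ← hR.tsum_prod]
    have hne : 2 * s + 3 ≠ 1 := by
      intro h
      have := congrArg Complex.re h
      simp at this
      linarith
    rw [Ez, Rs, zs_of_ne hne]
    rw [show 2 * (s + 2) - ((1 : ℕ) : ℂ) = 2 * s + 3 by push_cast; ring,
      show 2 * (s + 3) - ((3 : ℕ) : ℂ) = 2 * s + 3 by push_cast; ring,
      show 2 * (s + 1) - ((1 : ℕ) : ℂ) = 2 * s + 1 by push_cast; ring]
    push_cast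
    ring
  rw [← key]
  exact hsum.hasSum

/-- the convex region used for continuation -/
def VV : Set ℂ := {s : ℂ | -(3 / 2) < s.re ∧ s.re + 3 / 4 < s.im}

lemma VV_ne {s : ℂ} (hs : s ∈ VV) {t : ℝ} (ht : -(3 / 4) ≤ t) : s ≠ t := by
  rintro rfl
  have := hs.2
  simp at this
  linarith

lemma Ez_diff (ha : 0 < a) (hb : 0 < b) (hc : 0 < c) : DifferentiableOn ℂ (Ez a b c) VV := by
  intro s hs
  have n1 : s ≠ 1 / 2 := by simpa using VV_ne hs (t := 1 / 2) (by norm_num)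
  have n2 : s ≠ 1 := by simpa using VV_ne hs (t := 1) (by norm_num)
  have n3 : s ≠ 0 := by simpa using VV_ne hs (t := 0) (by norm_num)
  have n4 : s ≠ -1 / 2 := by simpa using VV_ne hs (t := -1 / 2) (by norm_num)
  have ha' : (a : ℂ) ≠ 0 := by exact_mod_cast ha.ne'
  have hz : ∀ k : ℂ, 2 * s + k ≠ 1 → DifferentiableAt ℂ (fun s => riemannZeta (2 * s + k)) s := by
    intro k hk
    exact DifferentiableAt.comp (g := riemannZeta) s (differentiableAt_riemannZeta hk) (by fun_prop)
  have z0 := hz 0 (fun h => n1 (by linear_combination h / 2))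
  have z1 := hz (-1) (fun h => n2 (by linear_combination h / 2))
  have z2 := hz 1 (fun h => n3 (by linear_combination h / 2))
  simp only [add_zero, ← sub_eq_add_neg] at z0 z1
  have p0 : DifferentiableAt ℂ (fun s => pw a s) s := pw_diff a s
  have pc : ∀ k : ℂ, DifferentiableAt ℂ (fun s => pw c (s + k)) s := fun k =>
    ((pw_diff c).comp (differentiable_id.add_const k)) s
  have pc0 : DifferentiableAt ℂ (fun s => pw c s) s := pw_diff c s
  have pc1 := pc 1
  have pc2 := pc 2
  have pc3 := pc 3
  have hzs : DifferentiableAt ℂ (fun s => zs (2 * s + 3)) s :=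
    DifferentiableAt.comp (g := zs) s (zs_diff _) (by fun_prop)
  have hR : DifferentiableAt ℂ (Rs a b c) s :=
    ((Rs_diff ha hb hc) s hs.1).differentiableAt ((isOpen_re _).mem_nhds hs.1)
  have hI2 : 1 / 2 < (s + 2).re := by
    have := hs.1
    simp
    linarith
  have hI : DifferentiableAt ℂ (fun s => Ic a b c (s + 2)) s :=
    DifferentiableAt.comp (g := Ic a b c) s
      (((Ic_diff ha hb hc) _ hI2).differentiableAt ((isOpen_re _).mem_nhds hI2)) (by fun_prop)
  have d1 : 2 * (a : ℂ) * (-1 - 2 * s) ≠ 0 := by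
    refine mul_ne_zero (by simpa using ha') fun h => n4 (by linear_combination -h / 2)
  have d2 : 2 * (a : ℂ) * (1 - 2 * s) ≠ 0 := by
    refine mul_ne_zero (by simpa using ha') fun h => n1 (by linear_combination -h / 2)
  have hIct : DifferentiableAt ℂ (Ict a b c) s := by
    unfold Ict
    fun_prop (disch := assumption)
  refine DifferentiableAt.differentiableWithinAt ?_
  unfold Ez
  fun_prop

/-- The value at -1. -/
def Vc (a b c : ℝ) : ℝ := (b ^ 3 - 6 * a * b * c) / 1440 * (1 / a ^ 2 + 1 / c ^ 2) + b / 144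

lemma Ez_neg_one (ha : 0 < a) (hc : 0 < c) : Ez a b c (-1) = Vc a b c := by
  have z2 : riemannZeta (2 * (-1)) = 0 := by
    have := riemannZeta_neg_two_mul_nat_add_one 0
    simpa using this
  have z3 : riemannZeta (2 * (-1) - 1) = 1 / 120 := by
    have := riemannZeta_neg_nat_eq_bernoulli 3
    norm_num [bernoulli_eq_bernoulli'_of_ne_one] at this ⊢
    rw [this]
  have z1 : riemannZeta (2 * (-1) + 1) = -1 / 12 := by
    have := riemannZeta_neg_nat_eq_bernoulli 1
    norm_num [bernoulli_eq_bernoulli'_of_ne_one] at this ⊢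
    rw [this]
  have ha' : (a : ℂ) ≠ 0 := by exact_mod_cast ha.ne'
  have hc' : (c : ℂ) ≠ 0 := by exact_mod_cast hc.ne'
  rw [Ez, z2, z3, z1, Rs_neg_one, Ict_neg_one ha hc, show (-1 : ℂ) + 1 = 0 by ring,
    show (2 : ℂ) * (-1) + 3 = 1 by ring, zs_one, show (-1 : ℂ) + 2 = 1 by ring,
    show (-1 : ℂ) + 3 = 2 by ring, pw_zero, pw_one hc, pw_two hc, Vc]
  push_cast
  field_simp
  ring

end cone

/-- The function of two signs describing the weight of a cone. -/
def hh (p q : ℝ) : ℝ :=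
  if 0 < p ∧ 0 < q then 1 else if (p = 0 ∧ 0 < q) ∨ (0 < p ∧ q = 0) then 1 / 2 else 0

lemma wt_eq (u v : ℝ × ℝ) (hD : 0 < u.2 * v.1 - u.1 * v.2) (m : ℤ × ℤ) :
    wt u v m = hh (u.2 * m.1 - u.1 * m.2) (m.2 * v.1 - m.1 * v.2) := by
  obtain ⟨u1, u2⟩ := u
  obtain ⟨v1, v2⟩ := v
  obtain ⟨m1, m2⟩ := m
  simp only at hD ⊢
  have hD' := hD.ne'
  have e1 : (∃ x₁ x₂ : ℝ, 0 < x₁ ∧ 0 < x₂ ∧ ((m1 : ℝ), (m2 : ℝ)) = x₁ • (u1, u2) + x₂ • (v1, v2)) ↔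
      (0 < u2 * m1 - u1 * m2 ∧ 0 < m2 * v1 - m1 * v2) := by
    constructor
    · rintro ⟨x, y, hx, hy, h⟩
      simp only [Prod.smul_mk, smul_eq_mul, Prod.mk_add_mk, Prod.mk.injEq] at h
      obtain ⟨h1, h2⟩ := h
      constructor
      · have : u2 * m1 - u1 * m2 = y * (u2 * v1 - u1 * v2) := by rw [h1, h2]; ring
        rw [this]; positivity
      · have : m2 * v1 - m1 * v2 = x * (u2 * v1 - u1 * v2) := by rw [h1, h2]; ring
        rw [this]; positivity
    · rintro ⟨hp, hq⟩
      refine ⟨(m2 * v1 - m1 * v2) / (u2 * v1 - u1 * v2),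
        (u2 * m1 - u1 * m2) / (u2 * v1 - u1 * v2), by positivity, by positivity, ?_⟩
      simp only [Prod.smul_mk, smul_eq_mul, Prod.mk_add_mk, Prod.mk.injEq]
      obtain ⟨D, hDd⟩ : ∃ D, D = u2 * v1 - u1 * v2 := ⟨_, rfl⟩
      rw [← hDd] at hD' ⊢
      constructor <;> field_simp <;> rw [hDd] <;> ring
  have e2 : (∃ t : ℝ, 0 < t ∧
      (((m1 : ℝ), (m2 : ℝ)) = t • (u1, u2) ∨ ((m1 : ℝ), (m2 : ℝ)) = t • (v1, v2))) ↔
      ((u2 * m1 - u1 * m2 = 0 ∧ 0 < m2 * v1 - m1 * v2) ∨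
        (0 < u2 * m1 - u1 * m2 ∧ m2 * v1 - m1 * v2 = 0)) := by
    constructor
    · rintro ⟨t, ht, h | h⟩ <;>
        simp only [Prod.smul_mk, smul_eq_mul, Prod.mk.injEq] at h <;> obtain ⟨h1, h2⟩ := h
      · left
        constructor
        · rw [h1, h2]; ring
        · have : m2 * v1 - m1 * v2 = t * (u2 * v1 - u1 * v2) := by rw [h1, h2]; ring
          rw [this]; positivity
      · right
        constructor
        · have : u2 * m1 - u1 * m2 = t * (u2 * v1 - u1 * v2) := by rw [h1, h2]; ring
          rw [this]; positivity
        · rw [h1, h2]; ring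
    · rintro (⟨hp, hq⟩ | ⟨hp, hq⟩)
      · refine ⟨(m2 * v1 - m1 * v2) / (u2 * v1 - u1 * v2), by positivity, Or.inl ?_⟩
        simp only [Prod.smul_mk, smul_eq_mul, Prod.mk.injEq]
        obtain ⟨D, hDd⟩ : ∃ D, D = u2 * v1 - u1 * v2 := ⟨_, rfl⟩
        rw [← hDd] at hD' ⊢
        constructor <;> field_simp <;> rw [hDd]
        · linear_combination v1 * hp
        · linear_combination v2 * hp
      · refine ⟨(u2 * m1 - u1 * m2) / (u2 * v1 - u1 * v2), by positivity, Or.inr ?_⟩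
        simp only [Prod.smul_mk, smul_eq_mul, Prod.mk.injEq]
        obtain ⟨D, hDd⟩ : ∃ D, D = u2 * v1 - u1 * v2 := ⟨_, rfl⟩
        rw [← hDd] at hD' ⊢
        constructor <;> field_simp <;> rw [hDd]
        · linear_combination u1 * hq
        · linear_combination u2 * hq
  unfold wt hh
  simp only [e1, e2]

lemma sgn_tri (p : ℝ) : (p < 0 ∧ ¬ 0 < p ∧ ¬ p = 0 ∧ 0 < -p) ∨ (p = 0 ∧ ¬ 0 < p ∧ p = 0 ∧ ¬ 0 < -p) ∨
    (0 < p ∧ 0 < p ∧ ¬ p = 0 ∧ ¬ 0 < -p) := by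
  rcases lt_trichotomy p 0 with hp | hp | hp
  · exact Or.inl ⟨hp, hp.not_gt, hp.ne, by linarith⟩
  · exact Or.inr (Or.inl ⟨hp, by simp [hp], hp, by simp [hp]⟩)
  · exact Or.inr (Or.inr ⟨hp, hp, hp.ne', by linarith⟩)

lemma sgn_aux {x y p q t : ℝ} (hx : 0 < x) (hy : 0 < y) (ht : t = y * q - x * p) :
    hh p q = hh p t + hh (-t) q := by
  unfold hh
  rcases sgn_tri p with ⟨hp, hp1, hp2, hp3⟩ | ⟨hp, hp1, hp2, hp3⟩ | ⟨hp, hp1, hp2, hp3⟩ <;>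
  rcases sgn_tri q with ⟨hq, hq1, hq2, hq3⟩ | ⟨hq, hq1, hq2, hq3⟩ | ⟨hq, hq1, hq2, hq3⟩ <;>
  rcases sgn_tri t with ⟨h, h1, h2, h3⟩ | ⟨h, h1, h2, h3⟩ | ⟨h, h1, h2, h3⟩
  all_goals first
    | (simp only [hp1, hp2, hq1, hq2, h1, h2, h3, neg_eq_zero, and_true, true_and, and_false,
        false_and, or_false, false_or, if_true, if_false]; norm_num; done)
    | (exfalso; nlinarith)

/-- The real vector of an integral vector. -/
def cs (u : ℤ × ℤ) : ℝ × ℝ := ((u.1 : ℝ), (u.2 : ℝ))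

/-- The zeta function of the cone spanned by `u, v` continues to `VV` with value `val` at `-1`. -/
def Good (Q : ℝ → ℝ → ℝ) (u v : ℤ × ℤ) (val : ℝ) : Prop :=
  ∃ E : ℂ → ℂ, DifferentiableOn ℂ E VV ∧
    (∀ s : ℂ, 1 < s.re → HasSum (fun m : ℤ × ℤ => (wt (cs u) (cs v) m : ℂ) *
      Complex.exp (-s * Complex.log ((Q (m.1 : ℝ) (m.2 : ℝ) : ℝ)))) (E s)) ∧ E (-1) = val

lemma Good_add {Q : ℝ → ℝ → ℝ} {u v w : ℤ × ℤ} {c d x y : ℝ} (h1 : Good Q u v c) (h2 : Good Q v w d)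
    (huv : 0 < u.2 * v.1 - u.1 * v.2) (hvw : 0 < v.2 * w.1 - v.1 * w.2)
    (huw : 0 < u.2 * w.1 - u.1 * w.2) (hx : 0 < x) (hy : 0 < y)
    (e1 : (v.1 : ℝ) = x * u.1 + y * w.1) (e2 : (v.2 : ℝ) = x * u.2 + y * w.2) :
    Good Q u w (c + d) := by
  obtain ⟨E, hE, hs, hv⟩ := h1
  obtain ⟨F, hF, ht, hw⟩ := h2
  refine ⟨fun s => E s + F s, hE.add hF, fun s h => ?_, by simp [hv, hw]⟩
  convert (hs s h).add (ht s h) using 2 with m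
  rw [← add_mul, ← Complex.ofReal_add]
  congr 2
  have c1 : (0 : ℝ) < u.2 * v.1 - u.1 * v.2 := by exact_mod_cast huv
  have c2 : (0 : ℝ) < v.2 * w.1 - v.1 * w.2 := by exact_mod_cast hvw
  have c3 : (0 : ℝ) < u.2 * w.1 - u.1 * w.2 := by exact_mod_cast huw
  rw [wt_eq (cs u) (cs v) c1, wt_eq (cs v) (cs w) c2, wt_eq (cs u) (cs w) c3]
  simp only [cs]
  rw [sgn_aux (t := m.2 * (v.1 : ℝ) - m.1 * v.2) hx hy (by rw [e1, e2]; ring)]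
  congr 2
  ring

lemma Good_unimod {Q : ℝ → ℝ → ℝ} {N w w' : ℝ} (hQ : ∀ x y, Q x y = N * (x * w + y) * (x * w' + y))
    (hN : 0 < N) {u v : ℤ × ℤ} (hD : u.2 * v.1 - u.1 * v.2 = 1)
    (hu : 0 < u.1 * w + u.2) (hu' : 0 < u.1 * w' + u.2)
    (hv : 0 < v.1 * w + v.2) (hv' : 0 < v.1 * w' + v.2) :
    Good Q u v (Vc (N * (u.1 * w + u.2) * (u.1 * w' + u.2))
      (N * ((u.1 * w + u.2) * (v.1 * w' + v.2) + (u.1 * w' + u.2) * (v.1 * w + v.2)))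
      (N * (v.1 * w + v.2) * (v.1 * w' + v.2))) := by
  set a := N * (u.1 * w + u.2) * (u.1 * w' + u.2) with ha
  set b := N * ((u.1 * w + u.2) * (v.1 * w' + v.2) + (u.1 * w' + u.2) * (v.1 * w + v.2)) with hb
  set c := N * (v.1 * w + v.2) * (v.1 * w' + v.2) with hc
  have ha0 : 0 < a := by positivity
  have hb0 : 0 < b := by positivity
  have hc0 : 0 < c := by positivity
  refine ⟨Ez a b c, Ez_diff ha0 hb0 hc0, fun s hs => ?_, Ez_neg_one ha0 hc0⟩
  have hR : (u.2 : ℝ) * v.1 - u.1 * v.2 = 1 := by exact_mod_cast hD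
  let g : ℕ × ℕ → ℤ × ℤ := fun p => ((p.2 : ℤ) * u.1 + p.1 * v.1, (p.2 : ℤ) * u.2 + p.1 * v.2)
  have hg : Function.Injective g := by
    rintro ⟨n, m⟩ ⟨n', m'⟩ h
    simp only [g, Prod.mk.injEq] at h
    obtain ⟨h1, h2⟩ := h
    have k1 : (n : ℤ) = n' := by
      linear_combination u.2 * h1 - u.1 * h2 + ((n' : ℤ) - n) * hD
    have k2 : (m : ℤ) = m' := by
      linear_combination v.1 * h2 - v.2 * h1 + ((m' : ℤ) - m) * hD
    simp only [Prod.mk.injEq]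
    omega
  have hwt : ∀ m : ℤ × ℤ, wt (cs u) (cs v) m =
      hh ((u.2 * m.1 - u.1 * m.2 : ℤ) : ℝ) ((m.2 * v.1 - m.1 * v.2 : ℤ) : ℝ) := by
    intro m
    rw [wt_eq _ _ (by simp only [cs]; rw [hR]; norm_num)]
    simp only [cs]
    push_cast
    rfl
  have key := cone_hasSum ha0 hb0 hc0 hs
  rw [← hg.hasSum_iff]
  · convert key using 2 with p
    obtain ⟨n, m⟩ := p
    simp only [Function.comp]
    have e1 : u.2 * (g (n, m)).1 - u.1 * (g (n, m)).2 = n := by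
      simp only [g]; linear_combination (n : ℤ) * hD
    have e2 : (g (n, m)).2 * v.1 - (g (n, m)).1 * v.2 = m := by
      simp only [g]; linear_combination (m : ℤ) * hD
    rw [hwt, e1, e2]
    have hW : hh ((n : ℤ) : ℝ) ((m : ℤ) : ℝ) = W (n, m) := by
      unfold hh W
      rcases Nat.eq_zero_or_pos n with rfl | hn <;> rcases Nat.eq_zero_or_pos m with rfl | hm
      · simp
      · simp [hm, hm.ne']
      · simp [hn, hn.ne']
      · simp [hn, hn.ne', hm, hm.ne']
    rw [hW]
    by_cases h0 : (n, m) = ((0, 0) : ℕ × ℕ)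
    · rw [h0]; simp [W]
    · congr 1
      rw [Tm, if_neg (by simpa using h0), G0, pw]
      have hq : Q ((g (n, m)).1 : ℝ) ((g (n, m)).2 : ℝ) = qf a b c n m := by
        rw [hQ, qf]
        simp only [g, ha, hb, hc]
        push_cast
        ring
      rw [hq, Complex.ofReal_log]
      unfold qf
      positivity
  · intro m hm
    rw [hwt]
    have : hh ((u.2 * m.1 - u.1 * m.2 : ℤ) : ℝ) ((m.2 * v.1 - m.1 * v.2 : ℤ) : ℝ) = 0 := by
      by_contra hne
      apply hm
      have hp : 0 ≤ u.2 * m.1 - u.1 * m.2 ∧ 0 ≤ m.2 * v.1 - m.1 * v.2 := by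
        unfold hh at hne
        split_ifs at hne with h1 h2
        · exact ⟨by exact_mod_cast h1.1.le, by exact_mod_cast h1.2.le⟩
        · rcases h2 with h2 | h2
          · exact ⟨by exact_mod_cast h2.1.ge, by exact_mod_cast h2.2.le⟩
          · exact ⟨by exact_mod_cast h2.1.le, by exact_mod_cast h2.2.ge⟩
        · exact absurd rfl hne
      refine ⟨((u.2 * m.1 - u.1 * m.2).toNat, (m.2 * v.1 - m.1 * v.2).toNat), ?_⟩
      simp only [g, Int.toNat_of_nonneg hp.1, Int.toNat_of_nonneg hp.2]
      ext
      · simp only; linear_combination m.1 * hD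
      · simp only; linear_combination m.2 * hD
    rw [this]
    simp

/-- Half of the trace of the cubic expression. -/
def Cf (N x x' y y' : ℝ) : ℝ :=
  N * (3 * y ^ 2 * y' / x - y ^ 3 * x' / x ^ 2 + 3 * y' ^ 2 * y / x' - y' ^ 3 * x / x' ^ 2) / 2

/-- The cocycle. -/
def Psi (N x x' y y' : ℝ) : ℝ :=
  N * (x * y' + x' * y) / 144 - (Cf N x x' y y' + Cf N y y' x x') / 720

lemma Vc_eq {N x x' y y' : ℝ} (hN : 0 < N) (hx : x ≠ 0) (hx' : x' ≠ 0) (hy : y ≠ 0) (hy' : y' ≠ 0) :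
    Vc (N * x * x') (N * (x * y' + x' * y)) (N * y * y') = Psi N x x' y y' := by
  have := hN.ne'
  unfold Vc Psi Cf
  field_simp
  ring

lemma Cf_add {N x x' y y' : ℝ} (hx : x ≠ 0) (hx' : x' ≠ 0) :
    Cf N x x' (x + y) (x' + y') =
      Cf N x x' y y' + N * (2 * x * x' + 3 * x * y' + 3 * y * x' + 6 * y * y') := by
  unfold Cf
  field_simp
  ring

lemma Cf_neg {N x x' y y' : ℝ} : Cf N x x' (-y) (-y') = - Cf N x x' y y' := by
  unfold Cf
  ring

lemma Psi_add {N x x' y y' z z' : ℝ} (hx : x ≠ 0) (hx' : x' ≠ 0) (hy : y ≠ 0) (hy' : y' ≠ 0)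
    (hz : z ≠ 0) (hz' : z' ≠ 0) (h : z = x + y) (h' : z' = x' + y') :
    Psi N x x' z z' = Psi N x x' y y' - Psi N z z' y y' := by
  have e1 := Cf_add (N := N) (y := y) (y' := y') hx hx'
  have e2 := Cf_add (N := N) (y := x) (y' := x') hy hy'
  have e3 := Cf_add (N := N) (y := -x) (y' := -x') hz hz'
  rw [Cf_neg, show z + -x = y by rw [h]; ring, show z' + -x' = y' by rw [h']; ring] at e3
  rw [← h, ← h'] at e1
  rw [show y + x = z by rw [h]; ring, show y' + x' = z' by rw [h']; ring] at e2
  unfold Psi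
  rw [e1, e2, e3, h, h']
  ring

lemma Good_chain {Q : ℝ → ℝ → ℝ} {N w w' : ℝ} (hQ : ∀ x y, Q x y = N * (x * w + y) * (x * w' + y))
    (hN : 0 < N) {p q : ℤ × ℤ} (hD : p.2 * q.1 - p.1 * q.2 = 1) {x x' y y' : ℝ}
    (hx : x = p.1 * w + p.2) (hx' : x' = p.1 * w' + p.2)
    (hy : y = q.1 * w + q.2) (hy' : y' = q.1 * w' + q.2)
    (hx0 : 0 < x) (hx0' : 0 < x') (hy0 : 0 < y) (hy0' : y' < 0) (k : ℕ)
    (hk : 0 < x' + ((k + 1 : ℕ) : ℝ) * y') :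
    Good Q p (p.1 + ((k + 1 : ℕ) : ℤ) * q.1, p.2 + ((k + 1 : ℕ) : ℤ) * q.2)
      (Psi N x x' y y' - Psi N (x + ((k + 1 : ℕ) : ℝ) * y) (x' + ((k + 1 : ℕ) : ℝ) * y') y y') := by
  -- one unimodular step
  have step : ∀ j : ℕ, 0 < x' + ((j + 1 : ℕ) : ℝ) * y' →
      Good Q (p.1 + (j : ℤ) * q.1, p.2 + (j : ℤ) * q.2)
        (p.1 + ((j + 1 : ℕ) : ℤ) * q.1, p.2 + ((j + 1 : ℕ) : ℤ) * q.2)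
        (Psi N (x + (j : ℝ) * y) (x' + (j : ℝ) * y') y y' -
          Psi N (x + ((j + 1 : ℕ) : ℝ) * y) (x' + ((j + 1 : ℕ) : ℝ) * y') y y') := by
    intro j hj
    have a1 : 0 < x + (j : ℝ) * y := by positivity
    have a2 : 0 < x + ((j + 1 : ℕ) : ℝ) * y := by positivity
    have a3 : 0 < x' + (j : ℝ) * y' := by
      push_cast at hj
      linarith
    have b1 : x + (j : ℝ) * y =
        ((p.1 + (j : ℤ) * q.1 : ℤ) : ℝ) * w + ((p.2 + (j : ℤ) * q.2 : ℤ) : ℝ) := by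
      push_cast; rw [hx, hy]; ring
    have b2 : x' + (j : ℝ) * y' =
        ((p.1 + (j : ℤ) * q.1 : ℤ) : ℝ) * w' + ((p.2 + (j : ℤ) * q.2 : ℤ) : ℝ) := by
      push_cast; rw [hx', hy']; ring
    have b3 : x + ((j + 1 : ℕ) : ℝ) * y = ((p.1 + ((j + 1 : ℕ) : ℤ) * q.1 : ℤ) : ℝ) * w +
        ((p.2 + ((j + 1 : ℕ) : ℤ) * q.2 : ℤ) : ℝ) := by
      push_cast; rw [hx, hy]; ring
    have b4 : x' + ((j + 1 : ℕ) : ℝ) * y' = ((p.1 + ((j + 1 : ℕ) : ℤ) * q.1 : ℤ) : ℝ) * w' +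
        ((p.2 + ((j + 1 : ℕ) : ℤ) * q.2 : ℤ) : ℝ) := by
      push_cast; rw [hx', hy']; ring
    have := Good_unimod hQ hN (u := (p.1 + (j : ℤ) * q.1, p.2 + (j : ℤ) * q.2))
      (v := (p.1 + ((j + 1 : ℕ) : ℤ) * q.1, p.2 + ((j + 1 : ℕ) : ℤ) * q.2))
      (by push_cast; linear_combination hD) (by rw [← b1]; exact a1) (by rw [← b2]; exact a3)
      (by rw [← b3]; exact a2) (by rw [← b4]; exact hj)
    simp only at this
    rw [← b1, ← b2, ← b3, ← b4, Vc_eq hN a1.ne' a3.ne' a2.ne' hj.ne',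
      Psi_add a1.ne' a3.ne' hy0.ne' hy0'.ne a2.ne' hj.ne' (by push_cast; ring)
        (by push_cast; ring)] at this
    exact this
  induction k with
  | zero => simpa using step 0 hk
  | succ k ih =>
    have hk0 : 0 < x' + ((k + 1 : ℕ) : ℝ) * y' := by
      push_cast at hk ⊢
      linarith
    have := Good_add (x := 1 / ((k : ℝ) + 2)) (y := ((k : ℝ) + 1) / ((k : ℝ) + 2)) (ih hk0)
      (step (k + 1) hk) (by
        have : p.2 * (p.1 + ((k + 1 : ℕ) : ℤ) * q.1) - p.1 * (p.2 + ((k + 1 : ℕ) : ℤ) * q.2)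
          = (k : ℤ) + 1 := by push_cast; linear_combination ((k : ℤ) + 1) * hD
        simp only
        rw [this]
        positivity) (by
        have : (p.2 + ((k + 1 : ℕ) : ℤ) * q.2) * (p.1 + ((k + 1 + 1 : ℕ) : ℤ) * q.1) -
          (p.1 + ((k + 1 : ℕ) : ℤ) * q.1) * (p.2 + ((k + 1 + 1 : ℕ) : ℤ) * q.2)
          = 1 := by push_cast; linear_combination hD
        simp only
        rw [this]
        positivity) (by
        have : p.2 * (p.1 + ((k + 1 + 1 : ℕ) : ℤ) * q.1) - p.1 * (p.2 + ((k + 1 + 1 : ℕ) : ℤ) * q.2)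
          = (k : ℤ) + 2 := by push_cast; linear_combination ((k : ℤ) + 2) * hD
        simp only
        rw [this]
        positivity) (by positivity) (by positivity)
        (by push_cast; field_simp; ring) (by push_cast; field_simp; ring)
    convert this using 1
    ring

lemma Psi_symm {N x x' y y' : ℝ} : Psi N x x' y y' = Psi N y y' x x' := by
  unfold Psi
  ring

lemma Good_main {Q : ℝ → ℝ → ℝ} {N w w' : ℝ} (hQ : ∀ x y, Q x y = N * (x * w + y) * (x * w' + y))
    (hN : 0 < N) (ℓ : ℕ) (a : ℕ → ℤ) (ha : ∀ i, 1 ≤ a i) (U : ℕ → ℤ × ℤ) (hU1 : U 1 = (0, 1))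
    (hU2 : U 2 = (1, 0))
    (hrec : ∀ n, n ≤ ℓ → (U (n + 2)).1 = a (ℓ - n) * (U (n + 1)).1 + (U n).1 ∧
      (U (n + 2)).2 = a (ℓ - n) * (U (n + 1)).2 + (U n).2)
    (Y Y' : ℕ → ℝ) (hY : ∀ n, Y n = (U n).1 * w + (U n).2)
    (hY' : ∀ n, Y' n = (U n).1 * w' + (U n).2)
    (hpos : ∀ n, n ≤ ℓ + 2 → 0 < Y n) (hsgn : ∀ n, n ≤ ℓ + 2 → 0 < (-1) ^ (n + 1) * Y' n) (j : ℕ)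
    (hj : 2 * j + 3 ≤ ℓ + 1) :
    Good Q (U 1) (U (2 * j + 3))
      (∑ i ∈ Finset.range (2 * j + 2),
        (-1) ^ i * Psi N (Y (i + 1)) (Y' (i + 1)) (Y (i + 2)) (Y' (i + 2))) := by
  -- determinants
  have hdet : ∀ n, n ≤ ℓ → (U (n + 1)).2 * (U (n + 2)).1 - (U (n + 1)).1 * (U (n + 2)).2
      = (-1) ^ n := by
    intro n hn
    induction n with
    | zero => simp [hU1, hU2]
    | succ n ih =>
      obtain ⟨h1, h2⟩ := hrec (n + 1) hn
      rw [show n + 1 + 2 = n + 3 by ring, show n + 1 + 1 = n + 2 by ring] at *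
      rw [h1, h2, pow_succ]
      linear_combination -ih (by omega)
  have hα : ∀ n, n ≤ ℓ → 0 ≤ (U (n + 1)).1 ∧ 0 < (U (n + 2)).1 := by
    intro n hn
    induction n with
    | zero => simp [hU1, hU2]
    | succ n ih =>
      obtain ⟨h1, h2⟩ := ih (by omega)
      refine ⟨h2.le, ?_⟩
      rw [(hrec (n + 1) hn).1]
      have := ha (ℓ - (n + 1))
      positivity
  have blk : ∀ j, 2 * j + 3 ≤ ℓ + 1 → Good Q (U (2 * j + 1)) (U (2 * j + 3))
      (Psi N (Y (2 * j + 1)) (Y' (2 * j + 1)) (Y (2 * j + 2)) (Y' (2 * j + 2)) -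
        Psi N (Y (2 * j + 3)) (Y' (2 * j + 3)) (Y (2 * j + 2)) (Y' (2 * j + 2))) := by
    intro j hj
    obtain ⟨h1, h2⟩ := hrec (2 * j + 1) (by omega)
    rw [show 2 * j + 1 + 2 = 2 * j + 3 by ring, show 2 * j + 1 + 1 = 2 * j + 2 by ring] at h1 h2
    have s1 := hsgn (2 * j + 1) (by omega)
    have s2 := hsgn (2 * j + 2) (by omega)
    have s3 := hsgn (2 * j + 3) (by omega)
    have o1 : ((-1 : ℝ)) ^ (2 * j + 1 + 1) = 1 := Even.neg_one_pow ⟨j + 1, by ring⟩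
    have o2 : ((-1 : ℝ)) ^ (2 * j + 2 + 1) = -1 := Odd.neg_one_pow ⟨j + 1, by ring⟩
    have o3 : ((-1 : ℝ)) ^ (2 * j + 3 + 1) = 1 := Even.neg_one_pow ⟨j + 2, by ring⟩
    rw [o1] at s1
    rw [o2] at s2
    rw [o3] at s3
    obtain ⟨k, hk⟩ : ∃ k : ℕ, a (ℓ - (2 * j + 1)) = ((k + 1 : ℕ) : ℤ) := by
      have := ha (ℓ - (2 * j + 1))
      exact ⟨(a (ℓ - (2 * j + 1)) - 1).toNat, by push_cast; omega⟩
    rw [hk] at h1 h2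
    have y3 : Y (2 * j + 3) = Y (2 * j + 1) + ((k + 1 : ℕ) : ℝ) * Y (2 * j + 2) := by
      rw [hY, hY, hY, h1, h2]; push_cast; ring
    have y3' : Y' (2 * j + 3) = Y' (2 * j + 1) + ((k + 1 : ℕ) : ℝ) * Y' (2 * j + 2) := by
      rw [hY', hY', hY', h1, h2]; push_cast; ring
    have hd := hdet (2 * j) (by omega)
    rw [Even.neg_one_pow ⟨j, by ring⟩] at hd
    have := Good_chain hQ hN hd (hY _) (hY' _) (hY _) (hY' _) (hpos _ (by omega)) (by linarith)
      (hpos _ (by omega)) (by linarith) k (by rw [← y3']; linarith)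
    rw [← y3, ← y3'] at this
    convert this using 1
    ext
    · rw [h1]; ring
    · rw [h2]; ring
  induction j with
  | zero =>
    have := blk 0 hj
    convert this using 1
    simp [Finset.sum_range_succ]
    rw [Psi_symm (x := Y 2)]
    ring
  | succ j ih =>
    have h1 := ih (by omega)
    have h2 := blk (j + 1) hj
    have u1 := (hα (2 * j + 1) (by omega)).2
    have u2 := (hα (2 * j + 3) (by omega)).2
    rw [show 2 * j + 1 + 2 = 2 * j + 3 by ring] at u1
    rw [show 2 * j + 3 + 2 = 2 * j + 5 by ring] at u2
    rw [show 2 * (j + 1) + 1 = 2 * j + 3 by ring, show 2 * (j + 1) + 2 = 2 * j + 4 by ring,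
      show 2 * (j + 1) + 3 = 2 * j + 5 by ring] at *
    have hd := hdet (2 * j + 2) (by omega)
    rw [Even.neg_one_pow ⟨j + 1, by ring⟩, show 2 * j + 2 + 1 = 2 * j + 3 by ring,
      show 2 * j + 2 + 2 = 2 * j + 4 by ring] at hd
    obtain ⟨r1, r2⟩ := hrec (2 * j + 3) (by omega)
    rw [show 2 * j + 3 + 1 = 2 * j + 4 by ring, show 2 * j + 3 + 2 = 2 * j + 5 by ring] at r1 r2
    have hdd : (U (2 * j + 3)).2 * (U (2 * j + 5)).1 - (U (2 * j + 3)).1 * (U (2 * j + 5)).2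
        = a (ℓ - (2 * j + 3)) := by
      rw [r1, r2]; linear_combination a (ℓ - (2 * j + 3)) * hd
    have hap := ha (ℓ - (2 * j + 3))
    have v1 : (0 : ℝ) < (U (2 * j + 3)).1 := by exact_mod_cast u1
    have v2 : (0 : ℝ) < (U (2 * j + 5)).1 := by exact_mod_cast u2
    have v3 : (0 : ℝ) < a (ℓ - (2 * j + 3)) := by exact_mod_cast hap
    have hddR : ((U (2 * j + 3)).2 : ℝ) * (U (2 * j + 5)).1 - (U (2 * j + 3)).1 * (U (2 * j + 5)).2
        = a (ℓ - (2 * j + 3)) := by exact_mod_cast hdd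
    have := Good_add (x := a (ℓ - (2 * j + 3)) / ((U (2 * j + 5)).1 : ℝ))
      (y := (U (2 * j + 3)).1 / ((U (2 * j + 5)).1 : ℝ)) h1 h2 (by simpa [hU1] using u1)
      (by rw [hdd]; omega) (by simpa [hU1] using u2) (by positivity) (by positivity)
      (by simp [hU1]; field_simp) (by simp [hU1]; field_simp; linarith)
    convert this using 1
    rw [Finset.sum_range_succ, Finset.sum_range_succ, Even.neg_one_pow ⟨j + 1, by ring⟩,
      Odd.neg_one_pow (n := 2 * j + 2 + 1) ⟨j + 1, by ring⟩]
    rw [Psi_symm (x := Y (2 * j + 5))]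
    ring_nf

lemma Cf_step {N x x' y y' t : ℝ} (hy : y ≠ 0) (hy' : y' ≠ 0) :
    Cf N y y' (x + t * y) (x' + t * y') - Cf N y y' x x' =
      t * (2 * (N * x * x') + N * (x * (x' + t * y') + (x + t * y) * x') +
        2 * (N * (x + t * y) * (x' + t * y'))) := by
  unfold Cf
  field_simp
  ring

lemma Cf_scale {N x x' y y' e e' : ℝ} (hx : x ≠ 0) (hx' : x' ≠ 0) (he : e * e' = 1) :
    Cf N (e * x) (e' * x') (e * y) (e' * y') = Cf N x x' y y' := by
  have h1 : e ≠ 0 := left_ne_zero_of_mul_eq_one he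
  have h2 : e' = e⁻¹ := eq_inv_of_mul_eq_one_right he
  subst h2
  unfold Cf
  field_simp

lemma alt_sum (t : ℕ → ℝ) (n : ℕ) :
    ∑ i ∈ Finset.range n, (-1) ^ i * (t i + t (i + 1)) = t 0 - (-1) ^ n * t n := by
  induction n with
  | zero => simp
  | succ n ih => rw [Finset.sum_range_succ, ih, pow_succ]; ring

lemma cf_mul (ℓ : ℕ) (a : ℕ → ℤ) (y : ℕ → ℝ) (hy : ∀ i, y i ≠ 0)
    (hrec : ∀ i, y i = a i + (y (i + 1))⁻¹) (hℓ1 : y (ℓ + 1) = y 1) (Y : ℕ → ℝ)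
    (hY0 : Y 0 = y 0 - a 0) (hY1 : Y 1 = 1)
    (hYrec : ∀ n, n ≤ ℓ → Y (n + 2) = a (ℓ - n) * Y (n + 1) + Y n) :
    ∀ n, n ≤ ℓ + 1 → Y (n + 1) = Y n * y (ℓ + 1 - n) := by
  intro n hn
  induction n with
  | zero =>
    have := hrec 0
    have h1 := hy 1
    simp only [zero_add, Nat.sub_zero] at *
    rw [hY1, hY0, hℓ1, this]
    field_simp
    ring
  | succ n ih =>
    have h := ih (by omega)
    have h1 := hy (ℓ - n + 1)
    rw [show ℓ + 1 - n = ℓ - n + 1 by omega] at h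
    rw [hYrec n (by omega), show ℓ + 1 - (n + 1) = ℓ - n by omega, hrec (ℓ - n), mul_add, h]
    field_simp

lemma identity_VV {Z E : ℂ → ℂ} (hZ : DifferentiableOn ℂ Z {(1 : ℂ)}ᶜ)
    (hE : DifferentiableOn ℂ E VV) (h : ∀ s : ℂ, 1 < s.re → Z s = E s) : Z (-1) = E (-1) := by
  have hVo : IsOpen VV := by
    have h1 : IsOpen {s : ℂ | -(3 / 2) < s.re} := isOpen_lt (by fun_prop) (by fun_prop)
    have h2 : IsOpen {s : ℂ | s.re + 3 / 4 < s.im} := isOpen_lt (by fun_prop) (by fun_prop)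
    exact h1.inter h2
  have hVc : Convex ℝ VV := by
    intro x hx z hz p q hp hq hpq
    simp only [VV, Set.mem_ofPred_eq, Complex.add_re, Complex.add_im, Complex.real_smul,
      Complex.mul_re, Complex.mul_im, Complex.ofReal_re, Complex.ofReal_im, zero_mul, sub_zero,
      add_zero] at *
    have e : q = 1 - p := by linarith
    subst e
    rcases eq_or_lt_of_le hp with h0 | h0
    · subst h0
      constructor <;> nlinarith
    · constructor <;> nlinarith [mul_pos h0 (sub_pos.2 hx.1), mul_pos h0 (sub_pos.2 hx.2),
        mul_nonneg hq (sub_pos.2 hz.1).le, mul_nonneg hq (sub_pos.2 hz.2).le]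
  have hsub : VV ⊆ {(1 : ℂ)}ᶜ := by
    intro s hs
    have := VV_ne hs (t := 1) (by norm_num)
    simpa using this
  have hZ' := (hZ.mono hsub).analyticOnNhd hVo
  have hE' := hE.analyticOnNhd hVo
  have hp : (⟨2, 3⟩ : ℂ) ∈ VV := by constructor <;> norm_num
  have hm : (-1 : ℂ) ∈ VV := by constructor <;> norm_num
  refine hZ'.eqOn_of_preconnected_of_eventuallyEq hE' hVc.isPreconnected hp ?_ hm
  have ho : IsOpen {s : ℂ | 1 < s.re} := isOpen_lt (by fun_prop) (by fun_prop)
  filter_upwards [ho.mem_nhds (show (⟨2, 3⟩ : ℂ) ∈ {s : ℂ | 1 < s.re} by norm_num)] with s hs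
  exact h s hs

lemma final_sum {N w w' : ℝ} (hw : w' < w) (ℓ : ℕ) (hev : Even ℓ) (a : ℕ → ℤ) (y y' Y Y' : ℕ → ℝ)
    (hY1 : Y 1 = 1) (hY1' : Y' 1 = 1) (hy0 : y 0 = w) (hy0' : y' 0 = w') (hY2 : Y 2 = w)
    (hY2' : Y' 2 = w')
    (hy1 : y 1 ≠ 0) (hy1' : y' 1 ≠ 0)
    (hℓ1 : y (ℓ + 1) = y 1) (hℓ1' : y' (ℓ + 1) = y' 1)
    (hne : ∀ n, n ≤ ℓ + 2 → Y n ≠ 0) (hne' : ∀ n, n ≤ ℓ + 2 → Y' n ≠ 0)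
    (hrec : ∀ n, n ≤ ℓ → Y (n + 2) = a (ℓ - n) * Y (n + 1) + Y n)
    (hrec' : ∀ n, n ≤ ℓ → Y' (n + 2) = a (ℓ - n) * Y' (n + 1) + Y' n)
    (hmul : ∀ n, n ≤ ℓ + 1 → Y (n + 1) = Y n * y (ℓ + 1 - n))
    (hmul' : ∀ n, n ≤ ℓ + 1 → Y' (n + 1) = Y' n * y' (ℓ + 1 - n))
    (M Lt Mt Nt : ℕ → ℝ)
    (hM : ∀ i, i < ℓ → M i = -(N * (Y (i + 2) * Y' (i + 1) + Y (i + 1) * Y' (i + 2))))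
    (hLt : ∀ i, i < ℓ → Lt i = N * Y i * Y' i)
    (hMt : ∀ i, i < ℓ → Mt i = N * (Y i * Y' (i + 2) + Y (i + 2) * Y' i))
    (hNt : ∀ i, i < ℓ → Nt i = N * Y (i + 2) * Y' (i + 2)) :
    (∑ i ∈ Finset.range ℓ, (-1) ^ i * Psi N (Y (i + 1)) (Y' (i + 1)) (Y (i + 2)) (Y' (i + 2))) =
      1 / 720 * ∑ i ∈ Finset.range ℓ, (-1) ^ (i + 1) *
        (5 * M i + (a (ℓ - i) : ℝ) * (2 * Lt i + Mt i + 2 * Nt i)) := by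
  -- the unit
  have wr : ∀ n, n ≤ ℓ → Y' (n + 1) * Y (n + 2) - Y (n + 1) * Y' (n + 2) = (-1) ^ n * (w - w') := by
    intro n hn
    induction n with
    | zero => simp [hY1, hY1', hY2, hY2']
    | succ n ih =>
      have h := ih (by omega)
      rw [show n + 1 + 2 = (n + 1) + 2 by ring, hrec (n + 1) hn, hrec' (n + 1) hn, pow_succ]
      rw [show n + 1 + 1 = n + 2 by ring]
      linear_combination -h
  have hunit : Y (ℓ + 1) * Y' (ℓ + 1) = 1 := by
    have h := wr ℓ le_rfl
    have e1 := hmul (ℓ + 1) le_rfl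
    have e2 := hmul' (ℓ + 1) le_rfl
    rw [Nat.sub_self, hy0] at e1
    rw [Nat.sub_self, hy0'] at e2
    rw [show ℓ + 2 = ℓ + 1 + 1 by ring, e1, e2, hev.neg_one_pow] at h
    have hww : w - w' ≠ 0 := (sub_pos.2 hw).ne'
    apply mul_right_cancel₀ hww
    linear_combination h
  have hz : Y ℓ = Y (ℓ + 1) * Y 0 := by
    have e1 := hmul ℓ (by omega)
    have e0 := hmul 0 (by omega)
    rw [show ℓ + 1 - ℓ = 1 by omega] at e1
    simp only [zero_add, Nat.sub_zero] at e0
    rw [hY1, hℓ1] at e0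
    rw [e1]
    linear_combination Y ℓ * e0
  have hz' : Y' ℓ = Y' (ℓ + 1) * Y' 0 := by
    have e1 := hmul' ℓ (by omega)
    have e0 := hmul' 0 (by omega)
    rw [show ℓ + 1 - ℓ = 1 by omega] at e1
    simp only [zero_add, Nat.sub_zero] at e0
    rw [hY1', hℓ1'] at e0
    rw [e1]
    linear_combination Y' ℓ * e0
  let t : ℕ → ℝ := fun i => Cf N (Y (i + 1)) (Y' (i + 1)) (Y i) (Y' i)
  have ht : t ℓ = t 0 := by
    have := Cf_scale (N := N) (x := 1) (x' := 1) (y := Y 0) (y' := Y' 0) one_ne_zero one_ne_zero hunit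
    rw [← hz, ← hz', mul_one, mul_one] at this
    simp only [t, this, zero_add, hY1, hY1']
  have hs := alt_sum t ℓ
  rw [hev.neg_one_pow, ht, one_mul, sub_self] at hs
  rw [← sub_eq_zero, Finset.mul_sum, ← Finset.sum_sub_distrib]
  rw [← mul_zero (-1 / 720 : ℝ), ← hs, Finset.mul_sum]
  refine Finset.sum_congr rfl fun i hi => ?_
  have hi' := Finset.mem_range.1 hi
  rw [hM i hi', hLt i hi', hMt i hi', hNt i hi']
  have st := Cf_step (N := N) (x := Y i) (x' := Y' i) (t := a (ℓ - i)) (hne (i + 1) (by omega))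
    (hne' (i + 1) (by omega))
  rw [show Y i + a (ℓ - i) * Y (i + 1) = Y (i + 2) by rw [hrec i (by omega)]; ring,
    show Y' i + a (ℓ - i) * Y' (i + 1) = Y' (i + 2) by rw [hrec' i (by omega)]; ring] at st
  rw [← st]
  simp only [t, Psi, pow_succ]
  rw [show i + 1 + 1 = i + 2 by ring]
  ring

end helpers

/- STATEMENT 19: ζ(−1,𝔟) = (1/720)·Σ_{i=0}^{ℓ−1} (−1)^{i−1}( 5M_i + a_{ℓ−i}(2L̃_i + M̃_i + 2Ñ_i) ). -/
theorem stmt_19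
    -- K is a real quadratic field with nontrivial automorphism `conj` and real embedding `ι`
    (K : Type) [Field K] [NumberField K] (hdeg : Module.finrank ℚ K = 2)
    (ι : K →+* ℝ) (conj : K ≃ₐ[ℚ] K) (hconj : conj ≠ AlgEquiv.refl)
    -- 𝔟 is a nonzero integral ideal with 𝔟⁻¹ = ℤ + ℤω
    (𝔟 : Ideal (𝓞 K)) (h𝔟 : 𝔟 ≠ 0) (ω : K)
    (hinv : ∀ x : K, x ∈ ((𝔟 : FractionalIdeal (𝓞 K)⁰ K))⁻¹ ↔
      ∃ c d : ℤ, x = (c : K) + (d : K) * ω)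
    (hω1 : 1 < ι ω) (hω'gt : -1 < ι (conj ω)) (hω'lt : ι (conj ω) < 0)
    -- purely periodic continued fraction expansion ω = [[a₀,…,a_{r−1}]]
    (r : ℕ) (hr : 0 < r) (a : ℕ → ℤ) (hapos : ∀ i, 1 ≤ a i) (haper : ∀ i, a (i + r) = a i)
    (w : ℕ → K) (hw0 : w 0 = ω) (hwgt : ∀ i, 1 < ι (w i))
    (hwrec : ∀ i, w i = (a i : K) + (w (i + 1))⁻¹) (hwper : ∀ i, w (i + r) = w i)
    -- the even period
    (ℓ : ℕ) (hℓ : ℓ = if r % 2 = 0 then r else 2 * r)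
    -- the sequences α, β (with α_{−2} = 1, β_{−2} = −a₀)
    (α β : ℤ → ℤ) (hαm2 : α (-2) = 1) (hαm1 : α (-1) = 0) (hα0 : α 0 = 1)
    (hβm2 : β (-2) = -(a 0)) (hβm1 : β (-1) = 1) (hβ0 : β 0 = 0)
    (hαrec : ∀ i : ℕ, i < ℓ → α ((i : ℤ) + 1) = a (ℓ - 1 - i) * α (i : ℤ) + α ((i : ℤ) - 1))
    (hβrec : ∀ i : ℕ, i < ℓ → β ((i : ℤ) + 1) = a (ℓ - 1 - i) * β (i : ℤ) + β ((i : ℤ) - 1))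
    -- the quadratic form Q(x,y) = N(𝔟)·(xω+y)(xω′+y), read through the real embedding
    (Q : ℝ → ℝ → ℝ)
    (hQ : ∀ x y : ℝ, Q x y =
      (Ideal.absNorm 𝔟 : ℝ) * (x * ι ω + y) * (x * ι (conj ω) + y))
    -- the rational numbers L_i, M_i, N_i and L̃_i, M̃_i, Ñ_i
    (L M N Lt Mt Nt : ℕ → ℚ)
    (hLMN : ∀ i < ℓ, ∀ h₁ h₂ : ℝ,
      Q ((α (i : ℤ) : ℝ) * h₁ - (α ((i : ℤ) - 1) : ℝ) * h₂)
        ((β (i : ℤ) : ℝ) * h₁ - (β ((i : ℤ) - 1) : ℝ) * h₂)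
      = (L i : ℝ) * h₁ ^ 2 + (M i : ℝ) * h₁ * h₂ + (N i : ℝ) * h₂ ^ 2)
    (hLMNt : ∀ i < ℓ, ∀ h₁ h₂ : ℝ,
      Q ((α ((i : ℤ) - 2) : ℝ) * h₁ + (α (i : ℤ) : ℝ) * h₂)
        ((β ((i : ℤ) - 2) : ℝ) * h₁ + (β (i : ℤ) : ℝ) * h₂)
      = (Lt i : ℝ) * h₁ ^ 2 + (Mt i : ℝ) * h₁ * h₂ + (Nt i : ℝ) * h₂ ^ 2)
    -- Z is the analytic continuation of the zeta function of (Q, σ)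
    (Z : ℂ → ℂ) (hZhol : DifferentiableOn ℂ Z {(1 : ℂ)}ᶜ)
    (hZeq : ∀ s : ℂ, 1 < s.re → Z s =
      ∑' m : ℤ × ℤ,
        (wt (0, 1) ((α ((ℓ : ℤ) - 1) : ℝ), (β ((ℓ : ℤ) - 1) : ℝ)) m : ℂ) *
          Complex.exp (-s * Complex.log ((Q (m.1 : ℝ) (m.2 : ℝ) : ℝ)))) :
    Z (-1) = ((1 / 720 : ℚ) * ∑ i ∈ Finset.range ℓ, (-1 : ℚ) ^ (i + 1) *
      (5 * M i + (a (ℓ - i) : ℚ) * (2 * Lt i + Mt i + 2 * Nt i)) : ℚ) := by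
  have hNpos : (0 : ℝ) < (Ideal.absNorm 𝔟 : ℝ) := by
    have : Ideal.absNorm 𝔟 ≠ 0 := by
      rw [Ne, Ideal.absNorm_eq_zero_iff]
      exact h𝔟
    exact_mod_cast Nat.pos_of_ne_zero this
  set ν : ℝ := (Ideal.absNorm 𝔟 : ℝ) with hν
  -- parity and periodicity
  have hev : Even ℓ := by
    rw [hℓ]
    split_ifs with h
    · exact Nat.even_iff.2 h
    · exact even_two_mul r
  have hℓ2 : 2 ≤ ℓ := by
    rw [hℓ]
    split_ifs with h <;> omega
  have haℓ : a ℓ = a 0 := by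
    rw [hℓ]
    split_ifs with h
    · simpa using haper 0
    · rw [two_mul, haper]; simpa using haper 0
  have hwℓ : w (ℓ + 1) = w 1 := by
    rw [hℓ]
    split_ifs with h
    · rw [add_comm, hwper]
    · rw [show 2 * r + 1 = 1 + r + r by ring, hwper, hwper]
  let y : ℕ → ℝ := fun i => ι (w i)
  let y' : ℕ → ℝ := fun i => ι (conj (w i))
  have hyrec : ∀ i, y i = a i + (y (i + 1))⁻¹ := by
    intro i
    simp only [y]
    conv_lhs => rw [hwrec i]
    simp
  have hyrec' : ∀ i, y' i = a i + (y' (i + 1))⁻¹ := by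
    intro i
    simp only [y']
    conv_lhs => rw [hwrec i]
    simp
  have hypos : ∀ i, 0 < y i := fun i => by
    have := hwgt i
    simp only [y]; linarith
  have hyneg : ∀ i, y' i < 0 := by
    intro i
    induction i with
    | zero => simp only [y', hw0]; exact hω'lt
    | succ i ih =>
      have h := hyrec' i
      have ha1 : (1 : ℝ) ≤ a i := by exact_mod_cast hapos i
      have : (y' (i + 1))⁻¹ < 0 := by linarith
      exact inv_lt_zero.1 this
  let U : ℕ → ℤ × ℤ := fun n => (α ((n : ℤ) - 2), β ((n : ℤ) - 2))
  have hU0 : U 0 = (1, -(a 0)) := by simp [U, hαm2, hβm2]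
  have hU1 : U 1 = (0, 1) := by simp [U, hαm1, hβm1]
  have hU2 : U 2 = (1, 0) := by simp [U, hα0, hβ0]
  have hUrec : ∀ n, n ≤ ℓ → (U (n + 2)).1 = a (ℓ - n) * (U (n + 1)).1 + (U n).1 ∧
      (U (n + 2)).2 = a (ℓ - n) * (U (n + 1)).2 + (U n).2 := by
    intro n hn
    cases n with
    | zero => simp [hU0, hU1, hU2, haℓ]
    | succ k =>
      have e1 : (((k + 1 + 2 : ℕ) : ℤ) - 2) = (k : ℤ) + 1 := by push_cast; ring
      have e2 : (((k + 1 + 1 : ℕ) : ℤ) - 2) = (k : ℤ) := by push_cast; ring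
      have e3 : (((k + 1 : ℕ) : ℤ) - 2) = (k : ℤ) - 1 := by push_cast; ring
      simp only [U, e1, e2, e3]
      rw [show ℓ - (k + 1) = ℓ - 1 - k by omega]
      exact ⟨hαrec k (by omega), hβrec k (by omega)⟩
  let Y : ℕ → ℝ := fun n => (U n).1 * ι ω + (U n).2
  let Y' : ℕ → ℝ := fun n => (U n).1 * ι (conj ω) + (U n).2
  have hYrec : ∀ n, n ≤ ℓ → Y (n + 2) = a (ℓ - n) * Y (n + 1) + Y n := by
    intro n hn
    obtain ⟨h1, h2⟩ := hUrec n hn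
    simp only [Y]
    rw [h1, h2]
    push_cast
    ring
  have hYrec' : ∀ n, n ≤ ℓ → Y' (n + 2) = a (ℓ - n) * Y' (n + 1) + Y' n := by
    intro n hn
    obtain ⟨h1, h2⟩ := hUrec n hn
    simp only [Y']
    rw [h1, h2]
    push_cast
    ring
  have hY1 : Y 1 = 1 := by simp [Y, hU1]
  have hY1' : Y' 1 = 1 := by simp [Y', hU1]
  have hY2 : Y 2 = ι ω := by simp [Y, hU2]
  have hY2' : Y' 2 = ι (conj ω) := by simp [Y', hU2]
  have hy0 : y 0 = ι ω := by simp only [y, hw0]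
  have hy0' : y' 0 = ι (conj ω) := by simp only [y', hw0]
  have hyℓ : y (ℓ + 1) = y 1 := by simp only [y, hwℓ]
  have hyℓ' : y' (ℓ + 1) = y' 1 := by simp only [y', hwℓ]
  have hmul := cf_mul ℓ a y (fun i => (hypos i).ne') hyrec hyℓ Y
    (by simp [Y, hU0, hy0, sub_eq_add_neg]) hY1 hYrec
  have hmul' := cf_mul ℓ a y' (fun i => (hyneg i).ne) hyrec' hyℓ' Y'
    (by simp [Y', hU0, hy0', sub_eq_add_neg]) hY1' hYrec'
  have hY0 : 0 < Y 0 := by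
    have h := hmul 0 (by omega)
    rw [zero_add, hY1] at h
    exact pos_of_mul_pos_left (by rw [← h]; norm_num) (hypos _).le
  have hY0' : Y' 0 < 0 := by
    have h := hmul' 0 (by omega)
    rw [zero_add, hY1'] at h
    by_contra hc
    have := mul_nonpos_of_nonneg_of_nonpos (not_lt.1 hc) (hyneg (ℓ + 1 - 0)).le
    linarith
  have hpos : ∀ n, n ≤ ℓ + 2 → 0 < Y n := by
    intro n hn
    induction n with
    | zero => exact hY0
    | succ n ih =>
      rw [hmul n (by omega)]
      exact mul_pos (ih (by omega)) (hypos _)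
  have hsgn : ∀ n, n ≤ ℓ + 2 → 0 < (-1) ^ (n + 1) * Y' n := by
    intro n hn
    induction n with
    | zero => simpa using hY0'
    | succ n ih =>
      rw [hmul' n (by omega), pow_succ]
      have := mul_pos (ih (by omega)) (neg_pos.2 (hyneg (ℓ + 1 - n)))
      linarith
  obtain ⟨j, hj⟩ : ∃ j, ℓ = 2 * j + 2 := by
    obtain ⟨k, hk⟩ := hev
    exact ⟨k - 1, by omega⟩
  have hgood := Good_main hQ hNpos ℓ a hapos U hU1 hU2 hUrec Y Y' (fun _ => rfl) (fun _ => rfl)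
    hpos hsgn j (by omega)
  rw [show 2 * j + 3 = ℓ + 1 by omega, show 2 * j + 2 = ℓ by omega] at hgood
  have hQ2 : ∀ p q s t h₁ h₂ : ℝ, Q (p * h₁ + s * h₂) (q * h₁ + t * h₂) =
      ν * (p * ι ω + q) * (p * ι (conj ω) + q) * h₁ ^ 2 +
      ν * ((p * ι ω + q) * (s * ι (conj ω) + t) + (s * ι ω + t) * (p * ι (conj ω) + q)) * h₁ * h₂ +
      ν * (s * ι ω + t) * (s * ι (conj ω) + t) * h₂ ^ 2 := by
    intro p q s t h₁ h₂
    rw [hQ]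
    ring
  have eU : ∀ i : ℕ, ((i : ℤ) = ((i + 2 : ℕ) : ℤ) - 2) ∧ ((i : ℤ) - 1 = ((i + 1 : ℕ) : ℤ) - 2) := by
    intro i
    constructor <;> push_cast <;> ring
  have hM : ∀ i, i < ℓ → (M i : ℝ) = -(ν * (Y (i + 2) * Y' (i + 1) + Y (i + 1) * Y' (i + 2))) := by
    intro i hi
    have h1 := hLMN i hi 1 1
    have h2 := hLMN i hi 1 (-1)
    rw [hQ] at h1 h2
    simp only [Y, Y', U]
    rw [← (eU i).1, ← (eU i).2]
    linear_combination (h2 - h1) / 2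
  have hT : ∀ i, i < ℓ → (Lt i : ℝ) = ν * Y i * Y' i ∧
      (Mt i : ℝ) = ν * (Y i * Y' (i + 2) + Y (i + 2) * Y' i) ∧
      (Nt i : ℝ) = ν * Y (i + 2) * Y' (i + 2) := by
    intro i hi
    have h1 := hLMNt i hi 1 0
    have h2 := hLMNt i hi 0 1
    have h3 := hLMNt i hi 1 1
    rw [hQ2] at h1 h2 h3
    simp only [Y, Y', U]
    rw [← (eU i).1]
    refine ⟨by linarith, by linarith, by linarith⟩
  have hne' : ∀ n, n ≤ ℓ + 2 → Y' n ≠ 0 := fun n hn h => by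
    have := hsgn n hn
    rw [h, mul_zero] at this
    exact lt_irrefl _ this
  rw [final_sum (N := ν) (hω'lt.trans (by linarith)) ℓ hev a y y' Y Y' hY1 hY1' hy0 hy0' hY2 hY2'
    (hypos 1).ne' (hyneg 1).ne hyℓ hyℓ' (fun n hn => (hpos n hn).ne') hne' hYrec hYrec' hmul hmul'
    (fun i => M i) (fun i => Lt i) (fun i => Mt i) (fun i => Nt i) hM (fun i hi => (hT i hi).1)
    (fun i hi => (hT i hi).2.1) (fun i hi => (hT i hi).2.2)] at hgood
  obtain ⟨E, hE, hsum, hval⟩ := hgood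
  have hcs1 : cs (U 1) = (0, 1) := by simp [cs, hU1]
  have hcs2 : cs (U (ℓ + 1)) = ((α ((ℓ : ℤ) - 1) : ℝ), (β ((ℓ : ℤ) - 1) : ℝ)) := by
    simp only [cs, U]
    rw [← (eU ℓ).2]
  rw [identity_VV hZhol hE fun s hs => ?_, hval]
  · push_cast
    rfl
  · rw [hZeq s hs]
    have := hsum s hs
    rw [hcs1, hcs2] at this
    exact this.tsum_eq

end
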